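/- For all spherical residues R₁,R₂ of a building X, the convex hull Conv(R₁,R₂) coincides with the closure of the interval [R₁,R₂] (the smallest closed subset of Res(X) containing [R₁,R₂]). Consequently, a subset ℛ ⊆ Res(X) is convex if and only if it is closed and [R₁,R₂] ⊆ ℛ for all R₁,R₂ ∈ ℛ. -/

import Mathlib

open Filter Topology

noncomputable section

variable {B : Type} {W : Type} [Group W] {M : CoxeterMatrix B}

/-- The subset `I` of the simple reflections is of *spherical type* if the standard
parabolic subgroup `W_I` it generates is finite. -/
def SphType (cs : CoxeterSystem M W) (I : Set B) : Prop :=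
  ((Subgroup.closure (cs.simple '' I) : Subgroup W) : Set W).Finite

/-- A building of type `(W,S)`, in the chamber-system (`W`-metric) approach:
a nonempty set of chambers with a Weyl-group-valued distance function `delta`. -/
structure Bldg (cs : CoxeterSystem M W) where
  Chamber : Type
  chamber_nonempty : Nonempty Chamber
  delta : Chamber → Chamber → W
  delta_eq_one_iff : ∀ C D, delta C D = 1 ↔ C = D
  delta_mem_pair : ∀ C D E (i : B), delta D E = cs.simple i →
    delta C E = delta C D * cs.simple i ∨ delta C E = delta C D
  delta_eq_of_length : ∀ C D E (i : B), delta D E = cs.simple i →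
    cs.length (delta C D * cs.simple i) = cs.length (delta C D) + 1 →
    delta C E = delta C D * cs.simple i
  exists_delta : ∀ C D (i : B), ∃ E, delta D E = cs.simple i ∧
    delta C E = delta C D * cs.simple i

namespace Bldg

variable {cs : CoxeterSystem M W} (X : Bldg cs)

instance : Nonempty X.Chamber := X.chamber_nonempty

instance : TopologicalSpace X.Chamber := ⊥
instance : DiscreteTopology X.Chamber := ⟨rfl⟩

/-- The gallery distance between two chambers. -/
def gdist (C D : X.Chamber) : ℕ := cs.length (X.delta C D)

/-- The `I`-residue of the chamber `C`. -/
def residue (I : Set B) (C : X.Chamber) : Set X.Chamber :=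
  {D | X.delta C D ∈ Subgroup.closure (cs.simple '' I)}

/-- `R` is a spherical residue. -/
def IsSphResidue (R : Set X.Chamber) : Prop :=
  ∃ (I : Set B) (C : X.Chamber), SphType cs I ∧ R = X.residue I C

/-- `R` is a panel, i.e. an `{s}`-residue. -/
def IsPanel (R : Set X.Chamber) : Prop :=
  ∃ (i : B) (C : X.Chamber), R = X.residue {i} C

/-- The set `Res(X)` of spherical residues of `X`. -/
def Res : Type := {R : Set X.Chamber // X.IsSphResidue R}

/-- The set of panels of `X`. -/
def Panel : Type := {R : Set X.Chamber // X.IsPanel R}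

instance : Nonempty X.Res := by
  obtain ⟨C⟩ := X.chamber_nonempty
  exact ⟨⟨X.residue ∅ C, ∅, C, by simp [SphType], rfl⟩⟩

instance : TopologicalSpace X.Res := ⊥
instance : DiscreteTopology X.Res := ⟨rfl⟩

/-- `R₁ ≤ R₂` : the spherical residue `R₂` contains `R₁`, i.e. `R₂ ⊆ R₁` as
sets of chambers. -/
def leRes (R₁ R₂ : X.Res) : Prop := R₂.1 ⊆ R₁.1

/-- The star `St(σ)` of a spherical residue. -/
def star (σ : X.Res) : Set X.Res := {τ | X.leRes σ τ}

/-- The gate (combinatorial projection) of the chamber `C` onto the residue `R` :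
the unique chamber of `R` through which pass minimal galleries from `C` to any
chamber of `R`. -/
def gate (R : Set X.Chamber) (C : X.Chamber) : X.Chamber :=
  Classical.epsilon fun D => D ∈ R ∧ ∀ E ∈ R, X.gdist C E = X.gdist C D + X.gdist D E

/-- The combinatorial projection of the residue `T` onto the residue `R`,
as a set of chambers. -/
def projSet (R T : Set X.Chamber) : Set X.Chamber := X.gate R '' T

/-- The combinatorial projection `proj_R(T)` of the spherical residue `T` onto
the spherical residue `R`, as a spherical residue. -/
def projRes (R T : X.Res) : X.Res :=
  Classical.epsilon fun U : X.Res => U.1 = X.projSet R.1 T.1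

/-- The map `proj_r : Res(X) → ∏_σ St(σ)` underlying the maximal combinatorial
bordification. -/
def projr (R : X.Res) : X.Res → X.Res := fun σ => X.projRes σ R

/-- The maximal combinatorial bordification `Cr(X)`: the closure of the image
of `proj_r`, each factor of the product being discrete. -/
def Cr : Set (X.Res → X.Res) := closure (Set.range X.projr)

/-- The map `proj_c : ch(X) → ∏_{σ panel} St(σ)` underlying the minimal
combinatorial bordification. -/
def projc (C : X.Chamber) : X.Panel → X.Chamber := fun σ => X.gate σ.1 C

/-- The minimal combinatorial bordification `Cc(X)`. -/
def Cc : Set (X.Panel → X.Chamber) := closure (Set.range X.projc)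

/-- A set of spherical residues is closed if it contains, with any residue,
all residues that it contains (in the order `leRes`). -/
def ClosedResSet (𝓡 : Set X.Res) : Prop :=
  ∀ R₁ R₂ : X.Res, X.leRes R₁ R₂ → R₂ ∈ 𝓡 → R₁ ∈ 𝓡

/-- A set of spherical residues is convex if it is closed and stable under
combinatorial projections. -/
def ConvexResSet (𝓡 : Set X.Res) : Prop :=
  X.ClosedResSet 𝓡 ∧ ∀ R₁ ∈ 𝓡, ∀ R₂ ∈ 𝓡, X.projRes R₁ R₂ ∈ 𝓡

/-- The closure of a set of spherical residues. -/
def resClosure (𝓡 : Set X.Res) : Set X.Res := ⋂₀ {𝓢 | X.ClosedResSet 𝓢 ∧ 𝓡 ⊆ 𝓢}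

/-- The convex hull of a set of spherical residues. -/
def convHull (𝓡 : Set X.Res) : Set X.Res := ⋂₀ {𝓢 | X.ConvexResSet 𝓢 ∧ 𝓡 ⊆ 𝓢}

/-- The convex hull `Conv(R₁,R₂)` of two spherical residues. -/
def conv2 (R₁ R₂ : X.Res) : Set X.Res := X.convHull {R₁, R₂}

/-- `α : W → ch(X)` is an apartment map: an isometric embedding of the Coxeter
complex. -/
def IsApartMap (α : W → X.Chamber) : Prop :=
  Function.Injective α ∧ ∀ v w : W, X.delta (α v) (α w) = v⁻¹ * w

/-- `A` is an apartment of `X`. -/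
def IsApartment (A : Set X.Chamber) : Prop :=
  ∃ α : W → X.Chamber, X.IsApartMap α ∧ A = Set.range α

/-- The residue `R` lies in the apartment `A`. -/
def LiesIn (R : X.Res) (A : Set X.Chamber) : Prop := (R.1 ∩ A).Nonempty

/-- `φ` is a root (half-apartment) of the apartment `A`. -/
def IsRootOf (A φ : Set X.Chamber) : Prop :=
  ∃ α : W → X.Chamber, X.IsApartMap α ∧ A = Set.range α ∧
    ∃ t : W, cs.IsReflection t ∧ φ = α '' {v : W | cs.length v < cs.length (t * v)}

/-- The residue `R` is contained in the root `φ` of the apartment `A`. -/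
def ContainedInRoot (R : X.Res) (A φ : Set X.Chamber) : Prop := R.1 ∩ A ⊆ φ

/-- `Φ_A(R₁,R₂)`: the set of roots of `A` containing `R₁` but not `R₂`. -/
def PhiSep (A : Set X.Chamber) (R₁ R₂ : X.Res) : Set (Set X.Chamber) :=
  {φ | X.IsRootOf A φ ∧ X.ContainedInRoot R₁ A φ ∧ ¬ X.ContainedInRoot R₂ A φ}

/-- A choice of apartment in which both `R₁` and `R₂` lie. -/
def chooseApt (R₁ R₂ : X.Res) : Set X.Chamber :=
  Classical.epsilon fun A : Set X.Chamber => X.IsApartment A ∧ X.LiesIn R₁ A ∧ X.LiesIn R₂ A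

/-- The root-distance between two spherical residues:
`d(R₁,R₂) = ½|Φ_A(R₁,R₂)| + ½|Φ_A(R₂,R₁)|` for an apartment `A` containing both. -/
def rootDist (R₁ R₂ : X.Res) : ℝ :=
  (((X.PhiSep (X.chooseApt R₁ R₂) R₁ R₂).ncard +
    (X.PhiSep (X.chooseApt R₁ R₂) R₂ R₁).ncard : ℕ) : ℝ) / 2

/-- The interval `[R₁,R₂]` determined by two spherical residues. -/
def interval (R₁ R₂ : X.Res) : Set X.Res :=
  {σ | X.rootDist R₁ R₂ = X.rootDist R₁ σ + X.rootDist σ R₂}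

/-- The retraction onto the apartment given by the apartment map `α`, centred at
the chamber `α 1`. -/
def retr (α : W → X.Chamber) (D : X.Chamber) : X.Chamber := α (X.delta (α 1) D)

/-- The retraction onto an apartment, acting on spherical residues: it maps the
`I`-residue of a chamber `D` to the `I`-residue of the retracted chamber. -/
def retrRes (α : W → X.Chamber) (R : X.Res) : X.Res :=
  Classical.epsilon fun T : X.Res =>
    ∃ (I : Set B) (D : X.Chamber), R.1 = X.residue I D ∧ T.1 = X.residue I (X.retr α D)

/-- The sequence `(R_n)` of spherical residues converges to `ξ` in the maximal
combinatorial bordification. -/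
def ConvSeq (ξ : X.Res → X.Res) (R : ℕ → X.Res) : Prop :=
  Tendsto (fun n => X.projr (R n)) atTop (nhds ξ)

/-- `Q(x, (R_n)) = ⋃_k ⋂_{n ≥ k} Conv(x, R_n)`. -/
def Qseq (x : X.Res) (R : ℕ → X.Res) : Set X.Res :=
  ⋃ k : ℕ, ⋂ n : ℕ, ⋂ _ : k ≤ n, X.conv2 x (R n)

/-- The combinatorial sector `Q(x,ξ)` based at `x` and pointing towards `ξ`. -/
def Qsector (x : X.Res) (ξ : X.Res → X.Res) : Set X.Res :=
  X.Qseq x (Classical.epsilon (X.ConvSeq ξ))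

/-- `Φ_A(ξ)`: the set of roots of the apartment `A` (with apartment map `α`) in
which every sequence of residues converging to `ξ`, retracted to `A`, eventually
lies. -/
def PhiXi (A : Set X.Chamber) (α : W → X.Chamber) (ξ : X.Res → X.Res) :
    Set (Set X.Chamber) :=
  {φ | X.IsRootOf A φ ∧ ∀ R : ℕ → X.Res, X.ConvSeq ξ R →
    ∃ N : ℕ, ∀ n > N, X.ContainedInRoot (X.retrRes α (R n)) A φ}

/-- `Φ_A(x)`: the set of roots of `A` containing the residue `x`. -/
def PhiRes (A : Set X.Chamber) (x : X.Res) : Set (Set X.Chamber) :=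
  {φ | X.IsRootOf A φ ∧ X.ContainedInRoot x A φ}

/-- The spherical residue `x` is a chamber (an `∅`-residue). -/
def IsChamberRes (x : X.Res) : Prop :=
  ∃ C : X.Chamber, x.1 = X.residue (∅ : Set B) C

/-- The automorphism group of the building: all permutations of the chambers
preserving the Weyl distance. -/
def autGroup : Subgroup (Equiv.Perm X.Chamber) where
  carrier := {g | ∀ C D : X.Chamber, X.delta (g C) (g D) = X.delta C D}
  one_mem' := by intro C D; simp
  mul_mem' := by
    intro a b ha hb C D
    simp only [Equiv.Perm.mul_apply]
    rw [ha, hb]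
  inv_mem' := by
    intro a ha C D
    have := ha (a⁻¹ C) (a⁻¹ D)
    simpa using this.symm

/-- `Aut(X)` as a type. -/
abbrev Aut : Type := ↥X.autGroup

/-- The topology of pointwise convergence on `Aut(X)` (the chamber set being
discrete). -/
instance : TopologicalSpace X.Aut :=
  TopologicalSpace.induced
    (fun g : X.Aut => ((g : Equiv.Perm X.Chamber) : X.Chamber → X.Chamber)) inferInstance

/-- The action of an automorphism on spherical residues. -/
def actRes (g : X.Aut) (R : X.Res) : X.Res :=
  Classical.epsilon fun T : X.Res => T.1 = (g : Equiv.Perm X.Chamber) '' R.1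

/-- The action of an automorphism on panels. -/
def actPanel (g : X.Aut) (σ : X.Panel) : X.Panel :=
  haveI : Nonempty X.Panel := ⟨σ⟩
  Classical.epsilon fun τ : X.Panel => τ.1 = (g : Equiv.Perm X.Chamber) '' σ.1

/-- The action of `Aut(X)` on the maximal combinatorial bordification:
`(g·f)(σ) = g·f(g⁻¹σ)`. -/
def actCr (g : X.Aut) (f : X.Res → X.Res) : X.Res → X.Res :=
  fun σ => X.actRes g (f (X.actRes g⁻¹ σ))

/-- The action of `Aut(X)` on the minimal combinatorial bordification. -/
def actCc (g : X.Aut) (f : X.Panel → X.Chamber) : X.Panel → X.Chamber :=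
  fun σ => (g : Equiv.Perm X.Chamber) (f (X.actPanel g⁻¹ σ))

/-- The building is locally finite: `S` is finite and panels are finite. -/
def LocallyFinite : Prop :=
  Finite B ∧ ∀ R : Set X.Chamber, X.IsPanel R → R.Finite

/-- The building is thick: every panel contains at least three chambers. -/
def Thick : Prop := ∀ R : Set X.Chamber, X.IsPanel R → 3 ≤ R.ncard

/-- The subgroup `G ≤ Aut(X)` acts strongly transitively: transitively on pairs
`(C, A)` of a chamber contained in an apartment. -/
def StronglyTransitive (G : Subgroup X.Aut) : Prop :=
  ∀ (C C' : X.Chamber) (A A' : Set X.Chamber),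
    X.IsApartment A → C ∈ A → X.IsApartment A' → C' ∈ A' →
    ∃ g ∈ G, (g : Equiv.Perm X.Chamber) C = C' ∧ (g : Equiv.Perm X.Chamber) '' A = A'

end Bldg

/-- A topological group is amenable if there is a left-invariant mean on the
space of bounded continuous real-valued functions on it. -/
def IsAmenableGroup (H : Type*) [Group H] [TopologicalSpace H] : Prop :=
  ∃ m : BoundedContinuousFunction H ℝ →ₗ[ℝ] ℝ,
    m 1 = 1 ∧ (∀ f : BoundedContinuousFunction H ℝ, (∀ x, 0 ≤ f x) → 0 ≤ m f) ∧
    ∀ (g : H) (f₁ f₂ : BoundedContinuousFunction H ℝ),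
      (∀ x, f₂ x = f₁ (g * x)) → m f₂ = m f₁

/-- A subset `K` of a topological group is topologically locally finite if every
finite subset of `K` generates a subgroup with compact closure. -/
def IsTLFSet {H : Type*} [Group H] [TopologicalSpace H] (K : Set H) : Prop :=
  ∀ s : Finset H, (s : Set H) ⊆ K →
    IsCompact (closure ((Subgroup.closure (s : Set H) : Subgroup H) : Set H))

/-- The space of closed subgroups of a topological group. -/
def ChabautySpace (H : Type*) [Group H] [TopologicalSpace H] : Type _ :=
  {K : Subgroup H // IsClosed (K : Set H)}

instance {H : Type*} [Group H] [TopologicalSpace H] : Nonempty (ChabautySpace H) :=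
  ⟨⟨⊤, by rw [Subgroup.coe_top]; exact isClosed_univ⟩⟩

/-- The Chabauty topology on the space of closed subgroups. -/
instance {H : Type*} [Group H] [TopologicalSpace H] : TopologicalSpace (ChabautySpace H) :=
  TopologicalSpace.generateFrom
    ({s | ∃ K : Set H, IsCompact K ∧ s = {L : ChabautySpace H | (L.1 : Set H) ∩ K = ∅}} ∪
     {s | ∃ U : Set H, IsOpen U ∧ s = {L : ChabautySpace H | ((L.1 : Set H) ∩ U).Nonempty}})

namespace Bldg

variable {cs : CoxeterSystem M W} (X : Bldg cs)

/-- The stabiliser in `G` of a spherical residue, as a set. -/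
def gstab (G : Subgroup X.Aut) (R : X.Res) : Set ↥G :=
  {g : ↥G | X.actRes (g : X.Aut) R = R}

/-- The stabiliser in `G` of a spherical residue, as a closed subgroup of `G`. -/
def gstabC (G : Subgroup X.Aut) (R : X.Res) : ChabautySpace ↥G :=
  Classical.epsilon fun L : ChabautySpace ↥G => (L.1 : Set ↥G) = X.gstab G R

/-- `D_ξ`: the union over `x ∈ Res(X)` of the pointwise fixators in `G` of the
combinatorial sectors `Q(x,ξ)`. -/
def gfixSector (G : Subgroup X.Aut) (ξ : X.Res → X.Res) : Set ↥G :=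
  {g : ↥G | ∃ x : X.Res, ∀ R ∈ X.Qsector x ξ, X.actRes (g : X.Aut) R = R}

/-- `D_ξ` as a closed subgroup of `G` (an element of the Chabauty space). -/
def DxiC (G : Subgroup X.Aut) (ξ : X.Res → X.Res) : ChabautySpace ↥G :=
  Classical.epsilon fun L : ChabautySpace ↥G => (L.1 : Set ↥G) = X.gfixSector G ξ

/-- The set of periodic elements of the stabiliser `G_ξ`. -/
def periodicStab (G : Subgroup X.Aut) (ξ : X.Res → X.Res) : Set ↥G :=
  {g : ↥G | X.actCr (g : X.Aut) ξ = ξ ∧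
    IsCompact (closure ((Subgroup.zpowers g : Subgroup ↥G) : Set ↥G))}

/-- The horofunction compactification of the chamber graph, with base point `y₀`. -/
def horoCh (y₀ : X.Chamber) : Set (X.Chamber → ℝ) :=
  closure (Set.range fun C : X.Chamber =>
    fun y : X.Chamber => (X.gdist C y : ℝ) - (X.gdist C y₀ : ℝ))

/-- The horofunction compactification of `(Res(X), root-distance)`, with base
point `z₀`. -/
def horoRes (z₀ : X.Res) : Set (X.Res → ℝ) :=
  closure (Set.range fun R : X.Res =>
    fun y : X.Res => X.rootDist R y - X.rootDist R z₀)

/-- The action of `Aut(X)` on horofunctions of the chamber graph. -/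
def actHoroCh (y₀ : X.Chamber) (g : X.Aut) (h : X.Chamber → ℝ) : X.Chamber → ℝ :=
  fun y => h (((g⁻¹ : X.Aut) : Equiv.Perm X.Chamber) y) -
    h (((g⁻¹ : X.Aut) : Equiv.Perm X.Chamber) y₀)

/-- The action of `Aut(X)` on horofunctions of `(Res(X), root-distance)`. -/
def actHoroRes (z₀ : X.Res) (g : X.Aut) (h : X.Res → ℝ) : X.Res → ℝ :=
  fun y => h (X.actRes g⁻¹ y) - h (X.actRes g⁻¹ z₀)

end Bldg

namespace CoxeterSystem

theorem end_mul_apply {α : Type*} (f g : Function.End α) (x : α) : (f * g) x = f (g x) := rfl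

open Classical in
/-- Conjugation by a simple reflection on signed elements of `W`, flipping the sign of
that simple reflection. -/
def signedConj (cs : CoxeterSystem M W) (i : B) : Function.End (W × ZMod 2) :=
  fun p => (cs.simple i * p.1 * cs.simple i, p.2 + if p.1 = cs.simple i then 1 else 0)

open Classical in
theorem signedConj_mul_pow_apply (cs : CoxeterSystem M W) (i j : B) (n : ℕ) (t : W) (b : ZMod 2) :
    ((cs.signedConj i * cs.signedConj j) ^ n) (t, b) =
      ((cs.simple i * cs.simple j) ^ n * t * ((cs.simple i * cs.simple j) ^ n)⁻¹,
        b + ∑ l ∈ Finset.range (2 * n),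
          if t = cs.simple j * (cs.simple i * cs.simple j) ^ l then 1 else 0) := by
  have hj : cs.simple j * cs.simple j = 1 := cs.simple_mul_simple_self j
  have hi : cs.simple i * cs.simple i = 1 := cs.simple_mul_simple_self i
  have hg : (cs.simple i * cs.simple j)⁻¹ = cs.simple j * cs.simple i := by simp
  induction n generalizing t b with
  | zero => simp [Function.End.one_def]
  | succ n ih =>
    rw [pow_succ, end_mul_apply]
    have h1 : (cs.signedConj i * cs.signedConj j) (t, b) =
        ((cs.simple i * cs.simple j) * t * (cs.simple i * cs.simple j)⁻¹,
          b + (if t = cs.simple j then 1 else 0) +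
            if t = cs.simple j * (cs.simple i * cs.simple j) then 1 else 0) := by
      rw [end_mul_apply]
      simp only [signedConj, hg, Prod.mk.injEq]
      refine ⟨by simp only [mul_assoc], ?_⟩
      congr 1
      refine if_congr ⟨fun h => ?_, fun h => ?_⟩ rfl rfl
      · rw [← h]; simp only [mul_assoc, hj, mul_one]; rw [← mul_assoc, hj, one_mul]
      · rw [h]; simp only [mul_assoc, hj, mul_one]; rw [← mul_assoc, hj, one_mul]
    rw [h1, ih]
    refine Prod.ext ?_ ?_
    · simp only [pow_succ, mul_inv_rev, mul_assoc]
    · simp only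
      rw [show 2 * (n + 1) = 2 * n + 1 + 1 by ring, Finset.sum_range_succ', Finset.sum_range_succ']
      simp only [pow_zero, mul_one, zero_add, pow_one]
      have : ∀ l, (cs.simple i * cs.simple j * t * (cs.simple i * cs.simple j)⁻¹ =
          cs.simple j * (cs.simple i * cs.simple j) ^ l) ↔
          t = cs.simple j * (cs.simple i * cs.simple j) ^ (l + 1 + 1) := by
        intro l
        rw [mul_inv_eq_iff_eq_mul, ← eq_inv_mul_iff_mul_eq, hg, pow_succ' _ (l + 1),
          pow_succ]
        simp only [mul_assoc]
      simp only [this]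
      ring

theorem isLiftable_signedConj (cs : CoxeterSystem M W) : M.IsLiftable cs.signedConj := by
  classical
  intro i j
  funext ⟨t, b⟩
  rw [signedConj_mul_pow_apply, cs.simple_mul_simple_pow]
  simp only [one_mul, inv_one, mul_one, Function.End.one_def, id]
  rw [two_mul, Finset.sum_range_add]
  simp only [pow_add, cs.simple_mul_simple_pow, one_mul]
  rw [← two_mul, show (2 : ZMod 2) = 0 from rfl, zero_mul, add_zero]

/-- The action of `W` on signed elements. -/
def signedAction (cs : CoxeterSystem M W) : W →* Function.End (W × ZMod 2) :=
  cs.lift ⟨cs.signedConj, cs.isLiftable_signedConj⟩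

theorem signedAction_apply (cs : CoxeterSystem M W) (w t : W) (b : ZMod 2) :
    cs.signedAction w (t, b) = (w * t * w⁻¹, b + (cs.signedAction w (t, 0)).2) := by
  induction w using cs.simple_induction_left generalizing t b with
  | one => simp [Function.End.one_def]
  | mul_simple_left w i ih =>
    have h : ∀ b, cs.signedAction (cs.simple i * w) (t, b) =
        cs.signedConj i (cs.signedAction w (t, b)) := by
      intro b
      rw [map_mul, end_mul_apply, signedAction, cs.lift_apply_simple]
    rw [h, h, ih, ih t 0]
    simp only [signedConj, zero_add, mul_inv_rev, inv_simple, mul_assoc, add_assoc]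

/-- The parity of the number of occurrences of `t` in the left inversion sequence of any
word for `w`. -/
def inversionParity (cs : CoxeterSystem M W) (w t : W) : ZMod 2 := (cs.signedAction w⁻¹ (t, 0)).2

theorem inversionParity_one (cs : CoxeterSystem M W) (t : W) : cs.inversionParity 1 t = 0 := by
  simp [inversionParity, Function.End.one_def]

theorem inversionParity_mul (cs : CoxeterSystem M W) (u v t : W) :
    cs.inversionParity (u * v) t = cs.inversionParity u t + cs.inversionParity v (u⁻¹ * t * u) := by
  rw [inversionParity, mul_inv_rev, map_mul, end_mul_apply,
    cs.signedAction_apply u⁻¹, cs.signedAction_apply v⁻¹]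
  simp [inversionParity]

open Classical in
theorem inversionParity_simple (cs : CoxeterSystem M W) (i : B) (t : W) :
    cs.inversionParity (cs.simple i) t = if t = cs.simple i then 1 else 0 := by
  simp [inversionParity, signedAction, signedConj]

theorem inversionParity_self (cs : CoxeterSystem M W) {t : W} (ht : cs.IsReflection t) :
    cs.inversionParity t t = 1 := by
  classical
  obtain ⟨u, i, rfl⟩ := ht
  have h := cs.inversionParity_mul u u⁻¹ (u * cs.simple i * u⁻¹)
  rw [mul_inv_cancel, inversionParity_one] at h
  rw [inversionParity_mul, inversionParity_mul, inversionParity_simple]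
  simp only [mul_assoc, inv_mul_cancel_left, inv_mul_cancel, mul_one, mul_inv_rev, inv_simple,
    simple_mul_simple_cancel_left, if_true] at h ⊢
  rw [add_right_comm, ← h, zero_add]

theorem exists_sublist_of_inversionParity (cs : CoxeterSystem M W) (ω : List B) (t : W)
    (h : cs.inversionParity (cs.wordProd ω) t ≠ 0) :
    ∃ ω' : List B, ω'.Sublist ω ∧ ω'.length < ω.length ∧ cs.wordProd ω' = t * cs.wordProd ω := by
  classical
  induction ω generalizing t with
  | nil => simp [inversionParity_one] at h
  | cons i ω ih =>
    rw [wordProd_cons, inversionParity_mul, inversionParity_simple] at h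
    by_cases hi : t = cs.simple i
    · exact ⟨ω, List.sublist_cons_self _ _, by simp, by simp [wordProd_cons, hi]⟩
    · rw [if_neg hi, zero_add] at h
      obtain ⟨ω', h1, h2, h3⟩ := ih _ h
      refine ⟨i :: ω', h1.cons_cons _, by simpa using h2, ?_⟩
      rw [wordProd_cons, h3, wordProd_cons]
      simp [mul_assoc]

theorem length_mul_lt_iff_inversionParity (cs : CoxeterSystem M W) {t : W}
    (ht : cs.IsReflection t) (w : W) :
    cs.length (t * w) < cs.length w ↔ cs.inversionParity w t = 1 := by
  have key : ∀ w, cs.inversionParity w t ≠ 0 → cs.length (t * w) < cs.length w := by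
    intro w h
    obtain ⟨ω, hω, rfl⟩ := cs.exists_isReduced w
    obtain ⟨ω', -, h2, h3⟩ := cs.exists_sublist_of_inversionParity ω t h
    rw [← h3, hω.eq]
    exact (cs.length_wordProd_le ω').trans_lt h2
  refine ⟨fun h => ?_, fun h => key w (by rw [h]; exact one_ne_zero)⟩
  by_contra h1
  have h0 : cs.inversionParity w t = 0 := by
    generalize cs.inversionParity w t = x at h1; revert x; decide
  have := key (t * w) (by
    rw [inversionParity_mul, cs.inversionParity_self ht]
    simp [h0])
  rw [← mul_assoc, ht.mul_self, one_mul] at this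
  omega

/-- The cocycle property of left inversions. -/
theorem isLeftInversion_mul_iff (cs : CoxeterSystem M W) {t : W} (ht : cs.IsReflection t)
    (u v : W) : cs.IsLeftInversion (u * v) t ↔
      ¬ (cs.IsLeftInversion u t ↔ cs.IsLeftInversion v (u⁻¹ * t * u)) := by
  have ht' : cs.IsReflection (u⁻¹ * t * u) := by simpa using ht.conj u⁻¹
  simp only [IsLeftInversion, ht, ht', true_and, cs.length_mul_lt_iff_inversionParity ht,
    cs.length_mul_lt_iff_inversionParity ht', inversionParity_mul]
  generalize cs.inversionParity u t = x
  generalize cs.inversionParity v _ = y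
  revert x y
  decide

end CoxeterSystem

namespace CoxeterSystem

variable (cs : CoxeterSystem M W)

theorem isLeftInversion_simple_iff (i : B) (t : W) :
    cs.IsLeftInversion (cs.simple i) t ↔ t = cs.simple i := by
  constructor
  · rintro ⟨-, h⟩
    rw [length_simple, Nat.lt_one_iff, length_eq_zero_iff] at h
    rw [eq_inv_of_mul_eq_one_left h, inv_simple]
  · rintro rfl
    exact ⟨cs.isReflection_simple i, by simp⟩

theorem leftInversions_finite_and_ncard (w : W) :
    {t | cs.IsLeftInversion w t}.Finite ∧ {t | cs.IsLeftInversion w t}.ncard = cs.length w := by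
  induction h : cs.length w generalizing w with
  | zero =>
    rw [length_eq_zero_iff] at h
    have : {t | cs.IsLeftInversion w t} = ∅ := by
      ext t; simp [IsLeftInversion, h]
    simp [this]
  | succ n ih =>
    obtain ⟨i, hi⟩ := cs.exists_rightDescent_of_ne_one (w := w) (by rintro rfl; simp at h)
    rw [isRightDescent_iff] at hi
    obtain ⟨hf, hc⟩ := ih (w * cs.simple i) (by omega)
    set v := w * cs.simple i with hv
    have hw : w = v * cs.simple i := by simp [hv]
    have ht : cs.IsReflection (v * cs.simple i * v⁻¹) := (cs.isReflection_simple i).conj v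
    have hset : {t | cs.IsLeftInversion w t} =
        insert (v * cs.simple i * v⁻¹) {t | cs.IsLeftInversion v t} := by
      have hn : ¬ cs.IsLeftInversion v (v * cs.simple i * v⁻¹) := by
        rintro ⟨-, h1⟩
        rw [inv_mul_cancel_right, ← hw] at h1; omega
      ext t
      simp only [Set.mem_ofPred_eq, Set.mem_insert_iff]
      by_cases htr : cs.IsReflection t
      · rw [hw, cs.isLeftInversion_mul_iff htr, isLeftInversion_simple_iff]
        have : v⁻¹ * t * v = cs.simple i ↔ t = v * cs.simple i * v⁻¹ := by
          rw [eq_mul_inv_iff_mul_eq, mul_assoc, inv_mul_eq_iff_eq_mul]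
        rw [this]
        by_cases h2 : t = v * cs.simple i * v⁻¹
        · subst h2; simp [hn]
        · simp [h2]
      · refine iff_of_false (fun h => htr h.1) ?_
        rintro (rfl | h2)
        · exact htr ht
        · exact htr h2.1
    have hn : v * cs.simple i * v⁻¹ ∉ {t | cs.IsLeftInversion v t} := by
      rintro ⟨-, h1⟩
      rw [inv_mul_cancel_right, ← hw] at h1; omega
    rw [hset]
    exact ⟨hf.insert _, by rw [Set.ncard_insert_of_notMem hn hf, hc]⟩

theorem leftInversions_finite (w : W) : {t | cs.IsLeftInversion w t}.Finite :=
  (cs.leftInversions_finite_and_ncard w).1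

theorem ncard_leftInversions (w : W) : {t | cs.IsLeftInversion w t}.ncard = cs.length w :=
  (cs.leftInversions_finite_and_ncard w).2

theorem length_mul_eq_add_iff (x y : W) :
    cs.length (x * y) = cs.length x + cs.length y ↔
      ∀ t, cs.IsLeftInversion x t → ¬ cs.IsLeftInversion y (x⁻¹ * t * x) := by
  set A := {t | cs.IsLeftInversion x t} with hA
  set C := (fun t => x * t * x⁻¹) '' {t | cs.IsLeftInversion y t} with hC
  have hAf : A.Finite := cs.leftInversions_finite x
  have hCf : C.Finite := (cs.leftInversions_finite y).image _
  have hAc : A.ncard = cs.length x := cs.ncard_leftInversions x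
  have hCc : C.ncard = cs.length y := by
    rw [hC, Set.ncard_image_of_injective _ (fun a b h => by simpa using h),
      cs.ncard_leftInversions]
  have hCm : ∀ t, t ∈ C ↔ cs.IsLeftInversion y (x⁻¹ * t * x) := by
    intro t
    constructor
    · rintro ⟨r, hr, rfl⟩
      simpa [mul_assoc] using hr
    · intro h
      exact ⟨_, h, by simp [mul_assoc]⟩
  have hx : {t | cs.IsLeftInversion (x * y) t} = (A ∪ C) \ (A ∩ C) := by
    ext t
    simp only [Set.mem_sdiff, Set.mem_union, Set.mem_inter_iff, hCm, hA, Set.mem_ofPred_eq]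
    by_cases ht : cs.IsReflection t
    · rw [cs.isLeftInversion_mul_iff ht]; tauto
    · refine iff_of_false (fun h => ht h.1) ?_
      rintro ⟨h | h, -⟩
      · exact ht h.1
      · exact ht ((cs.isReflection_conj_iff x⁻¹ t).1 (by simpa using h.1))
  have h1 := Set.ncard_union_add_ncard_inter A C hAf hCf
  have h2 := Set.ncard_sdiff_add_ncard_of_subset
    (show A ∩ C ⊆ A ∪ C from Set.inter_subset_left.trans Set.subset_union_left) (hAf.union hCf)
  rw [← hx, cs.ncard_leftInversions] at h2
  have h3 : cs.length (x * y) = cs.length x + cs.length y ↔ (A ∩ C).ncard = 0 := by omega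
  rw [h3, Set.ncard_eq_zero (hAf.inter_of_left C), Set.eq_empty_iff_forall_notMem]
  refine forall_congr' fun t => ?_
  rw [Set.mem_inter_iff, hCm]
  simp [hA]

/-- The standard parabolic subgroup `W_I`. -/
abbrev parabolic (I : Set B) : Subgroup W := Subgroup.closure (cs.simple '' I)

theorem simple_mem_parabolic {I : Set B} {i : B} (hi : i ∈ I) : cs.simple i ∈ cs.parabolic I :=
  Subgroup.subset_closure ⟨i, hi, rfl⟩

theorem wordProd_mem_parabolic {I : Set B} {ω : List B} (h : ∀ i ∈ ω, i ∈ I) :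
    cs.wordProd ω ∈ cs.parabolic I := by
  induction ω with
  | nil => simp [one_mem]
  | cons i ω ih =>
    rw [wordProd_cons]
    exact mul_mem (cs.simple_mem_parabolic (h i (by simp)))
      (ih fun j hj => h j (List.mem_cons_of_mem _ hj))

theorem exists_sublist_of_isLeftInversion (ω : List B) (t : W)
    (h : cs.IsLeftInversion (cs.wordProd ω) t) :
    ∃ ω' : List B, ω'.Sublist ω ∧ ω'.length < ω.length ∧ cs.wordProd ω' = t * cs.wordProd ω :=
  cs.exists_sublist_of_inversionParity ω t
    (by rw [(cs.length_mul_lt_iff_inversionParity h.1 _).1 h.2]; exact one_ne_zero)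

theorem exists_isReduced_of_mem_parabolic {I : Set B} {y : W} (hy : y ∈ cs.parabolic I) :
    ∃ ω : List B, cs.IsReduced ω ∧ (∀ i ∈ ω, i ∈ I) ∧ cs.wordProd ω = y := by
  have key : ∀ i ∈ I, ∀ y, (∃ ω : List B, cs.IsReduced ω ∧ (∀ i ∈ ω, i ∈ I) ∧ cs.wordProd ω = y) →
      ∃ ω : List B, cs.IsReduced ω ∧ (∀ i ∈ ω, i ∈ I) ∧ cs.wordProd ω = cs.simple i * y := by
    rintro i hi _ ⟨ω, hω, hI, rfl⟩
    rcases cs.length_simple_mul (cs.wordProd ω) i with h | h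
    · refine ⟨i :: ω, ?_, ?_, cs.wordProd_cons i ω⟩
      · rw [IsReduced, wordProd_cons, h, hω.eq, List.length_cons]
      · simpa [hi] using hI
    · obtain ⟨ω', h1, h2, h3⟩ := cs.exists_sublist_of_isLeftInversion ω (cs.simple i)
        ⟨cs.isReflection_simple i, by omega⟩
      refine ⟨ω', ?_, fun j hj => hI j (h1.subset hj), h3⟩
      have := cs.length_wordProd_le ω'
      have := hω.eq
      rw [IsReduced]
      rw [h3] at *
      omega
  induction hy using Subgroup.closure_induction_left with
  | one => exact ⟨[], by simp [IsReduced], by simp, by simp⟩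
  | mul_left x hx y _ ih =>
    obtain ⟨i, hi, rfl⟩ := hx
    exact key i hi y ih
  | inv_mul_cancel x hx y _ ih =>
    obtain ⟨i, hi, rfl⟩ := hx
    rw [inv_simple]
    exact key i hi y ih

theorem IsLeftInversion.mem_parabolic {cs : CoxeterSystem M W} {I : Set B} {y t : W}
    (h : cs.IsLeftInversion y t) (hy : y ∈ cs.parabolic I) : t ∈ cs.parabolic I := by
  obtain ⟨ω, -, hI, rfl⟩ := cs.exists_isReduced_of_mem_parabolic hy
  obtain ⟨ω', h1, -, h3⟩ := cs.exists_sublist_of_isLeftInversion ω t h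
  have h4 := cs.wordProd_mem_parabolic fun j hj => hI j (h1.subset hj)
  rw [h3] at h4
  exact (Subgroup.mul_mem_cancel_right _ hy).1 h4

theorem exists_leftDescent_of_mem_parabolic {I : Set B} {y : W} (hy : y ∈ cs.parabolic I)
    (h1 : y ≠ 1) : ∃ i ∈ I, cs.IsLeftDescent y i := by
  obtain ⟨ω, hω, hI, rfl⟩ := cs.exists_isReduced_of_mem_parabolic hy
  cases ω with
  | nil => simp at h1
  | cons i ω =>
    refine ⟨i, hI i (by simp), ?_⟩
    rw [IsLeftDescent, hω.eq, wordProd_cons, simple_mul_simple_cancel_left, List.length_cons]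
    exact (cs.length_wordProd_le ω).trans_lt (Nat.lt_succ_self _)

theorem exists_rightDescent_of_mem_parabolic {I : Set B} {y : W} (hy : y ∈ cs.parabolic I)
    (h1 : y ≠ 1) : ∃ i ∈ I, cs.IsRightDescent y i := by
  obtain ⟨i, hi, h⟩ := cs.exists_leftDescent_of_mem_parabolic (inv_mem hy) (inv_ne_one.2 h1)
  exact ⟨i, hi, cs.isLeftDescent_inv_iff.1 h⟩

/-- No reflection of the subgroup `H` is a left inversion of `w`. -/
def LeftMinimal (H : Subgroup W) (w : W) : Prop := ∀ t ∈ H, ¬ cs.IsLeftInversion w t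

theorem exists_leftMinimal_mul (H : Subgroup W) (w : W) : ∃ y ∈ H, cs.LeftMinimal H (y * w) := by
  classical
  have hex : ∃ n, ∃ y ∈ H, cs.length (y * w) = n := ⟨_, 1, one_mem H, rfl⟩
  obtain ⟨y, hy, hn⟩ := Nat.find_spec hex
  refine ⟨y, hy, fun t ht h => ?_⟩
  have h2 := h.2
  rw [hn, ← mul_assoc] at h2
  exact Nat.find_min hex h2 ⟨t * y, mul_mem ht hy, rfl⟩

variable {cs}

theorem LeftMinimal.mono {H K : Subgroup W} {w : W}
    (h : cs.LeftMinimal K w) (hHK : H ≤ K) : cs.LeftMinimal H w := fun t ht => h t (hHK ht)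

theorem LeftMinimal.length_mul {I : Set B} {w y : W} (hw : cs.LeftMinimal (cs.parabolic I) w)
    (hy : y ∈ cs.parabolic I) : cs.length (y * w) = cs.length y + cs.length w := by
  rw [length_mul_eq_add_iff]
  intro t ht
  exact hw _ (mul_mem (mul_mem (inv_mem hy) (ht.mem_parabolic hy)) hy)

theorem IsLeftInversion.mul_right {x y t : W} (h : cs.IsLeftInversion x t)
    (hl : cs.length (x * y) = cs.length x + cs.length y) : cs.IsLeftInversion (x * y) t := by
  rw [cs.isLeftInversion_mul_iff h.1]
  have := (cs.length_mul_eq_add_iff x y).1 hl t h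
  tauto

theorem isReflection_conj_inv {t : W} (ht : cs.IsReflection t) (u : W) :
    cs.IsReflection (u⁻¹ * t * u) := by simpa using ht.conj u⁻¹

/-- If `w` is minimal in `W_I w` then `W_I ∩ w W_J w⁻¹` is a standard
parabolic subgroup. -/
theorem mem_parabolic_inter_iff {I J : Set B} {w : W} (hI : cs.LeftMinimal (cs.parabolic I) w)
    (x : W) :
    x ∈ cs.parabolic {i | i ∈ I ∧ w⁻¹ * cs.simple i * w ∈ cs.parabolic J} ↔
      x ∈ cs.parabolic I ∧ w⁻¹ * x * w ∈ cs.parabolic J := by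
  constructor
  · intro hx
    induction hx using Subgroup.closure_induction with
    | mem x hx =>
      obtain ⟨i, hi, rfl⟩ := hx
      exact ⟨cs.simple_mem_parabolic hi.1, hi.2⟩
    | one => simp [one_mem]
    | mul x y _ _ hx hy =>
      refine ⟨mul_mem hx.1 hy.1, ?_⟩
      have := mul_mem hx.2 hy.2
      simpa [mul_assoc] using this
    | inv x _ hx =>
      refine ⟨inv_mem hx.1, ?_⟩
      have := inv_mem hx.2
      simpa [mul_assoc] using this
  · rintro ⟨hxI, hxJ⟩
    induction h : cs.length x using Nat.strong_induction_on generalizing x with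
    | _ n ih =>
      subst h
      by_cases hx1 : x = 1
      · rw [hx1]; exact one_mem _
      obtain ⟨i, hi, hdesc⟩ := cs.exists_leftDescent_of_mem_parabolic hxI hx1
      have hinv : cs.IsLeftInversion x (cs.simple i) := ⟨cs.isReflection_simple i, hdesc⟩
      have h1 : cs.IsLeftInversion (x * w) (cs.simple i) := hinv.mul_right (hI.length_mul hxI)
      rw [show x * w = w * (w⁻¹ * x * w) by simp [mul_assoc],
        cs.isLeftInversion_mul_iff hinv.1] at h1
      have h2 := hI _ (cs.simple_mem_parabolic hi)
      have h3 : w⁻¹ * cs.simple i * w ∈ cs.parabolic J := by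
        have : cs.IsLeftInversion (w⁻¹ * x * w) (w⁻¹ * cs.simple i * w) := by tauto
        exact this.mem_parabolic hxJ
      have h4 := ih _ hdesc (cs.simple i * x) (mul_mem (cs.simple_mem_parabolic hi) hxI)
        (by simpa [mul_assoc] using mul_mem h3 hxJ) rfl
      have h5 := mul_mem (cs.simple_mem_parabolic
        (I := {i | i ∈ I ∧ w⁻¹ * cs.simple i * w ∈ cs.parabolic J}) (i := i) ⟨hi, h3⟩) h4
      simpa using h5

/-- The `W_I`-component of an element of `w W_J`, for `w` minimal in `W_I w`, lies in
`w W_J w⁻¹`. -/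
theorem exists_leftMinimal_of_mem_parabolic {I J : Set B} {w y : W}
    (hI : cs.LeftMinimal (cs.parabolic I) w) (hy : y ∈ cs.parabolic J) :
    ∃ x ∈ cs.parabolic I, w⁻¹ * x * w ∈ cs.parabolic J ∧
      cs.LeftMinimal (cs.parabolic I) (x * (w * y)) := by
  let H : Subgroup W := cs.parabolic J ⊓ (cs.parabolic I).comap (MulAut.conj w).toMonoidHom
  have hH : ∀ z, z ∈ H ↔ z ∈ cs.parabolic J ∧ w * z * w⁻¹ ∈ cs.parabolic I := by
    intro z; simp [H, Subgroup.mem_inf]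
  obtain ⟨z, hz, hmin⟩ := cs.exists_leftMinimal_mul H y
  rw [hH] at hz
  refine ⟨w * z * w⁻¹, hz.2, by simpa [mul_assoc] using hz.1, fun t ht h => ?_⟩
  rw [show w * z * w⁻¹ * (w * y) = w * (z * y) by simp [mul_assoc],
    cs.isLeftInversion_mul_iff h.1] at h
  have h1 := hI t ht
  have h2 : cs.IsLeftInversion (z * y) (w⁻¹ * t * w) := by tauto
  refine hmin _ ((hH _).2 ⟨h2.mem_parabolic (mul_mem hz.1 hy), ?_⟩) h2
  simpa [mul_assoc] using ht

theorem length_eq_add_of_forall_isLeftDescent {K : Set B} {z y : W}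
    (hz : ∀ k ∈ K, cs.IsLeftDescent z k) (hy : y ∈ cs.parabolic K) :
    cs.length z = cs.length y + cs.length (y⁻¹ * z) := by
  induction h : cs.length y using Nat.strong_induction_on generalizing y with
  | _ n ih =>
    subst h
    by_cases hy1 : y = 1
    · simp [hy1]
    obtain ⟨k, hk, hd⟩ := cs.exists_leftDescent_of_mem_parabolic hy hy1
    set y' := cs.simple k * y with hy'
    have hyy : y = cs.simple k * y' := by simp [hy']
    have hy'm : y' ∈ cs.parabolic K := mul_mem (cs.simple_mem_parabolic hk) hy
    have ih' := ih _ hd hy'm rfl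
    have hkr := cs.isReflection_simple k
    have hkz : cs.IsLeftInversion (y' * (y'⁻¹ * z)) (cs.simple k) :=
      ⟨hkr, by rw [mul_inv_cancel_left]; exact hz k hk⟩
    rw [cs.isLeftInversion_mul_iff hkr] at hkz
    have hky : ¬ cs.IsLeftInversion y' (cs.simple k) := by
      rintro ⟨-, h⟩
      rw [← hyy] at h
      exact absurd h (not_lt.2 (le_of_lt hd))
    have h2 : cs.IsLeftInversion (y'⁻¹ * z) (y'⁻¹ * cs.simple k * y') := by tauto
    have h3 := h2.2
    have h4 : y'⁻¹ * cs.simple k * y' * (y'⁻¹ * z) = y⁻¹ * z := by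
      rw [hyy]; simp [mul_assoc]
    rw [h4] at h3
    have h5 := (cs.isLeftDescent_iff).1 hd
    have h6 := cs.length_mul_le y (y⁻¹ * z)
    rw [mul_inv_cancel_left] at h6
    omega

theorem isLeftInversion_of_forall_isLeftDescent {K : Set B} {z t : W}
    (hz : ∀ k ∈ K, cs.IsLeftDescent z k) (ht : t ∈ cs.parabolic K) (hr : cs.IsReflection t) :
    cs.IsLeftInversion z t := by
  have h1 := length_eq_add_of_forall_isLeftDescent hz ht
  have h2 : cs.IsLeftInversion t t := ⟨hr, by
    rw [hr.mul_self, length_one, Nat.pos_iff_ne_zero, Ne, length_eq_zero_iff]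
    rintro rfl
    simpa using hr.odd_length⟩
  have := h2.mul_right (y := t⁻¹ * z) (by rw [mul_inv_cancel_left]; exact h1)
  rwa [mul_inv_cancel_left] at this

theorem sphType_of_forall_isLeftDescent {K : Set B} {z : W}
    (hz : ∀ k ∈ K, cs.IsLeftDescent z k) : SphType cs K := by
  refine Set.Finite.of_injOn (f := fun y => {t | cs.IsLeftInversion y t})
    (t := {s | s ⊆ {t | cs.IsLeftInversion z t}}) ?_ ?_ (cs.leftInversions_finite z).finite_subsets
  · intro y hy t ht
    have ht : cs.IsLeftInversion y t := ht
    have := ht.mul_right (y := y⁻¹ * z)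
      (by rw [mul_inv_cancel_left]; exact length_eq_add_of_forall_isLeftDescent hz hy)
    rwa [mul_inv_cancel_left] at this
  · intro y _ y' _ h
    have h : ∀ t, cs.IsLeftInversion y t ↔ cs.IsLeftInversion y' t := fun t => Set.ext_iff.1 h t
    have h0 : {t | cs.IsLeftInversion (y⁻¹ * y') t} = ∅ := by
      ext t
      simp only [Set.mem_ofPred_eq, Set.mem_empty_iff_false, iff_false]
      intro ht
      have hr : cs.IsReflection (y * t * y⁻¹) := ht.1.conj y
      have h1 := cs.isLeftInversion_mul_iff hr y (y⁻¹ * y')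
      rw [mul_inv_cancel_left, show y⁻¹ * (y * t * y⁻¹) * y = t by simp [mul_assoc]] at h1
      have := h (y * t * y⁻¹)
      tauto
    have h1 := cs.ncard_leftInversions (y⁻¹ * y')
    rw [h0, Set.ncard_empty] at h1
    exact inv_mul_eq_one.1 ((cs.length_eq_zero_iff).1 h1.symm)

/-- A finite standard parabolic subgroup has a longest element. -/
theorem exists_longest {J : Set B} (hJ : SphType cs J) :
    ∃ z ∈ cs.parabolic J, ∀ t ∈ cs.parabolic J, cs.IsReflection t → cs.IsLeftInversion z t := by
  obtain ⟨z, hz, hmax⟩ := Set.exists_max_image _ cs.length hJ ⟨1, one_mem _⟩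
  refine ⟨z, hz, fun t ht hr => ⟨hr, ?_⟩⟩
  exact lt_of_le_of_ne (hmax _ (mul_mem ht hz)) (hr.length_mul_right_ne z)

end CoxeterSystem

namespace CoxeterSystem

variable (cs : CoxeterSystem M W)

/-- The reflection `t` separates the elements `u` and `v`. -/
def Sep (t u v : W) : Prop :=
  cs.IsReflection t ∧ ¬ (cs.IsLeftInversion u t ↔ cs.IsLeftInversion v t)

variable {cs}

theorem sep_iff {t : W} (ht : cs.IsReflection t) (u v : W) :
    cs.Sep t u v ↔ cs.IsLeftInversion (u⁻¹ * v) (u⁻¹ * t * u) := by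
  have := cs.isLeftInversion_mul_iff ht u (u⁻¹ * v)
  rw [mul_inv_cancel_left] at this
  simp only [Sep, ht, true_and]
  tauto

theorem sep_conj_iff {t : W} (ht : cs.IsReflection t) (u v : W) :
    cs.Sep (u * t * u⁻¹) u v ↔ cs.IsLeftInversion (u⁻¹ * v) t := by
  rw [sep_iff (ht.conj u)]
  simp [mul_assoc]

theorem Sep.symm {t u v : W} (h : cs.Sep t u v) : cs.Sep t v u :=
  ⟨h.1, fun h' => h.2 h'.symm⟩

variable (cs)

theorem setOf_sep_eq (u v : W) :
    {t | cs.Sep t u v} = (fun t => u * t * u⁻¹) '' {t | cs.IsLeftInversion (u⁻¹ * v) t} := by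
  ext t
  simp only [Set.mem_ofPred_eq, Set.mem_image]
  constructor
  · intro h
    exact ⟨u⁻¹ * t * u, (sep_iff h.1 u v).1 h, by simp [mul_assoc]⟩
  · rintro ⟨x, hx, rfl⟩
    exact (sep_conj_iff hx.1 u v).2 hx

theorem sep_finite (u v : W) : {t | cs.Sep t u v}.Finite := by
  rw [setOf_sep_eq]
  exact (cs.leftInversions_finite _).image _

theorem ncard_sep (u v : W) : {t | cs.Sep t u v}.ncard = cs.length (u⁻¹ * v) := by
  rw [setOf_sep_eq, Set.ncard_image_of_injective, ncard_leftInversions]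
  intro a b h
  simpa using h

theorem length_eq_add_iff_sep (a b c : W) :
    cs.length (a⁻¹ * c) = cs.length (a⁻¹ * b) + cs.length (b⁻¹ * c) ↔
      ∀ t, cs.Sep t a b → ¬ cs.Sep t b c := by
  have h := cs.length_mul_eq_add_iff (a⁻¹ * b) (b⁻¹ * c)
  rw [show a⁻¹ * b * (b⁻¹ * c) = a⁻¹ * c by simp [mul_assoc]] at h
  rw [h]
  constructor
  · intro h t h1 h2
    refine h _ ((sep_iff h1.1 a b).1 h1) ?_
    rw [show (a⁻¹ * b)⁻¹ * (a⁻¹ * t * a) * (a⁻¹ * b) = b⁻¹ * t * b by simp [mul_assoc]]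
    exact (sep_iff h1.1 b c).1 h2
  · intro h t h1 h2
    have h3 := (sep_conj_iff h1.1 a b).2 h1
    refine h _ h3 ((sep_iff h3.1 b c).2 ?_)
    convert h2 using 1
    simp [mul_assoc]

variable {cs}

theorem Sep.conj_mem_parabolic {I : Set B} {t u v : W} (h : cs.Sep t u v)
    (huv : u⁻¹ * v ∈ cs.parabolic I) : u⁻¹ * t * u ∈ cs.parabolic I :=
  ((sep_iff h.1 u v).1 h).mem_parabolic huv

theorem LeftMinimal.not_sep {H : Subgroup W} {u v t : W} (h : cs.LeftMinimal H (u⁻¹ * v))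
    (ht : u⁻¹ * t * u ∈ H) : ¬ cs.Sep t u v :=
  fun hs => h _ ht ((sep_iff hs.1 u v).1 hs)

theorem LeftMinimal.length_mul_inv {I : Set B} {w y : W}
    (hw : cs.LeftMinimal (cs.parabolic I) w⁻¹) (hy : y ∈ cs.parabolic I) :
    cs.length (w * y) = cs.length w + cs.length y := by
  have := hw.length_mul (inv_mem hy)
  rw [← mul_inv_rev, length_inv, length_inv, length_inv] at this
  omega

end CoxeterSystem

namespace Bldg

open CoxeterSystem

variable {cs : CoxeterSystem M W} (X : Bldg cs)

@[simp] theorem delta_self (C : X.Chamber) : X.delta C C = 1 := (X.delta_eq_one_iff C C).2 rfl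

theorem delta_simple_symm {C D : X.Chamber} {i : B} (h : X.delta C D = cs.simple i) :
    X.delta D C = cs.simple i := by
  obtain ⟨E, hE, hCE⟩ := X.exists_delta C D i
  rw [h, cs.simple_mul_simple_self, X.delta_eq_one_iff] at hCE
  rw [hCE]; exact hE

theorem delta_eq_mul {C D E : X.Chamber} (h : cs.length (X.delta C D * X.delta D E) =
    cs.length (X.delta C D) + cs.length (X.delta D E)) :
    X.delta C E = X.delta C D * X.delta D E := by
  induction hn : cs.length (X.delta D E) generalizing E with
  | zero =>
    rw [length_eq_zero_iff] at hn
    rw [hn, mul_one, (X.delta_eq_one_iff D E).1 hn]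
  | succ n ih =>
    obtain ⟨i, hi⟩ := cs.exists_rightDescent_of_ne_one (w := X.delta D E)
      (by intro h; simp [h] at hn)
    rw [isRightDescent_iff] at hi
    obtain ⟨F, hEF, hDF⟩ := X.exists_delta D E i
    have h1 := cs.length_mul_le (X.delta C D) (X.delta D F)
    have h2 := cs.length_mul_le (X.delta C D * X.delta D F) (cs.simple i)
    have h0 : X.delta D F * cs.simple i = X.delta D E := by simp [hDF]
    rw [mul_assoc, h0, length_simple] at h2
    rw [← hDF] at hi
    have h3 := ih (E := F) (by omega) (by omega)
    rw [X.delta_eq_of_length C F E i (X.delta_simple_symm hEF), h3, mul_assoc, h0]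
    rw [h3, mul_assoc, h0]; omega

theorem delta_inv (C D : X.Chamber) : (X.delta C D)⁻¹ = X.delta D C := by
  induction hn : cs.length (X.delta C D) generalizing D with
  | zero =>
    rw [length_eq_zero_iff] at hn
    rw [hn, (X.delta_eq_one_iff C D).1 hn]; simp
  | succ n ih =>
    obtain ⟨i, hi⟩ := cs.exists_rightDescent_of_ne_one (w := X.delta C D)
      (by intro h; simp [h] at hn)
    rw [isRightDescent_iff] at hi
    obtain ⟨F, hDF, hCF⟩ := X.exists_delta C D i
    have h1 := ih F (by rw [hCF]; omega)
    have h2 : X.delta D F * X.delta F C = (X.delta C D)⁻¹ := by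
      rw [hDF, ← h1, hCF]; simp
    rw [← h2]
    refine (X.delta_eq_mul ?_).symm
    rw [h2, ← h1, length_inv, length_inv, hDF, length_simple, hCF]; omega

theorem gdist_comm (C D : X.Chamber) : X.gdist C D = X.gdist D C := by
  rw [gdist, gdist, ← delta_inv, length_inv]

theorem gdist_triangle (C D E : X.Chamber) : X.gdist C E ≤ X.gdist C D + X.gdist D E := by
  unfold gdist
  induction hn : cs.length (X.delta D E) generalizing E with
  | zero =>
    rw [length_eq_zero_iff, X.delta_eq_one_iff] at hn
    rw [hn]; rfl
  | succ n ih =>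
    obtain ⟨i, hi⟩ := cs.exists_rightDescent_of_ne_one (w := X.delta D E)
      (by intro h; simp [h] at hn)
    rw [isRightDescent_iff] at hi
    obtain ⟨F, hEF, hDF⟩ := X.exists_delta D E i
    have h1 := ih F (by rw [hDF]; omega)
    have h3 := cs.length_mul_le (X.delta C F) (cs.simple i)
    rw [length_simple] at h3
    rcases X.delta_mem_pair C F E i (X.delta_simple_symm hEF) with h | h <;> rw [h] <;> omega

theorem gdist_eq_zero_iff {C D : X.Chamber} : X.gdist C D = 0 ↔ C = D := by
  rw [gdist, length_eq_zero_iff, delta_eq_one_iff]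

/-- If `δ(D,E)` lies in a standard parabolic subgroup, then so does `δ(C,D)⁻¹ δ(C,E)`. -/
theorem delta_inv_mul_mem {J : Set B} {D E : X.Chamber} (h : X.delta D E ∈ cs.parabolic J)
    (C : X.Chamber) : (X.delta C D)⁻¹ * X.delta C E ∈ cs.parabolic J := by
  induction hn : cs.length (X.delta D E) generalizing E with
  | zero =>
    rw [length_eq_zero_iff, X.delta_eq_one_iff] at hn
    rw [hn]; simp [one_mem]
  | succ n ih =>
    obtain ⟨i, hiJ, hi⟩ := cs.exists_rightDescent_of_mem_parabolic h (by
      intro h; simp [h] at hn)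
    rw [isRightDescent_iff] at hi
    obtain ⟨F, hEF, hDF⟩ := X.exists_delta D E i
    have hs := cs.simple_mem_parabolic hiJ
    have h1 := ih (E := F) (by rw [hDF]; exact mul_mem h hs) (by rw [hDF]; omega)
    rcases X.delta_mem_pair C F E i (X.delta_simple_symm hEF) with h | h <;> rw [h]
    · rw [← mul_assoc]; exact mul_mem h1 hs
    · exact h1

theorem delta_mem_parabolic_trans {J : Set B} {C D E : X.Chamber}
    (h : X.delta C D ∈ cs.parabolic J) (h' : X.delta D E ∈ cs.parabolic J) :
    X.delta C E ∈ cs.parabolic J := by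
  have := mul_mem h (X.delta_inv_mul_mem h' C)
  rwa [mul_inv_cancel_left] at this

theorem delta_mem_parabolic_symm {J : Set B} {C D : X.Chamber}
    (h : X.delta C D ∈ cs.parabolic J) : X.delta D C ∈ cs.parabolic J := by
  rw [← delta_inv]; exact inv_mem h

theorem mem_residue_self (I : Set B) (C : X.Chamber) : C ∈ X.residue I C := by
  simp [residue, one_mem]

theorem residue_eq {I : Set B} {C D : X.Chamber} (h : D ∈ X.residue I C) :
    X.residue I D = X.residue I C := by
  have h : X.delta C D ∈ cs.parabolic I := h
  ext E
  exact ⟨fun h' => X.delta_mem_parabolic_trans h h',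
    fun h' => X.delta_mem_parabolic_trans (X.delta_mem_parabolic_symm h) h'⟩

theorem exists_delta_eq (C : X.Chamber) (w : W) : ∃ D, X.delta C D = w := by
  induction w using cs.simple_induction_right with
  | one => exact ⟨C, X.delta_self C⟩
  | mul_simple_right w i ih =>
    obtain ⟨D, hD⟩ := ih
    obtain ⟨E, -, h⟩ := X.exists_delta C D i
    exact ⟨E, by rw [h, hD]⟩

theorem exists_between {C E : X.Chamber} {u v : W} (h : X.delta C E = u * v)
    (hl : cs.length (u * v) = cs.length u + cs.length v) :
    ∃ D, X.delta C D = u ∧ X.delta D E = v := by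
  induction hn : cs.length v generalizing E v with
  | zero =>
    rw [length_eq_zero_iff] at hn
    exact ⟨E, by rw [h, hn, mul_one], by rw [hn, delta_self]⟩
  | succ n ih =>
    obtain ⟨i, hi⟩ := cs.exists_rightDescent_of_ne_one (w := v) (by rintro rfl; simp at hn)
    rw [isRightDescent_iff] at hi
    obtain ⟨F, hEF, hCF⟩ := X.exists_delta C E i
    rw [h, mul_assoc] at hCF
    have h2 := cs.length_mul_le (u * (v * cs.simple i)) (cs.simple i)
    rw [← mul_assoc u, mul_assoc _ (cs.simple i), cs.simple_mul_simple_self, mul_one,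
      mul_assoc, length_simple] at h2
    have h3 := cs.length_mul_le u (v * cs.simple i)
    obtain ⟨G, hG, hGF⟩ := ih hCF (by omega) (by omega)
    refine ⟨G, hG, ?_⟩
    have h4 : X.delta G F * X.delta F E = v := by
      rw [hGF, X.delta_simple_symm hEF]; simp
    rw [← h4]
    apply X.delta_eq_mul
    rw [h4, hGF, X.delta_simple_symm hEF, length_simple]; omega

theorem delta_eq_mul_of_gdist {C D E : X.Chamber}
    (h : X.gdist C E = X.gdist C D + X.gdist D E) :
    X.delta C E = X.delta C D * X.delta D E := by
  induction hn : X.gdist D E generalizing E with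
  | zero => rw [(X.gdist_eq_zero_iff).1 hn, delta_self, mul_one]
  | succ n ih =>
    obtain ⟨i, hi⟩ := cs.exists_rightDescent_of_ne_one (w := X.delta D E)
      (by intro h; simp [gdist, h] at hn)
    rw [isRightDescent_iff] at hi
    obtain ⟨F, hEF, hDF⟩ := X.exists_delta D E i
    rw [← hDF] at hi
    have hFE := X.delta_simple_symm hEF
    have h1 := X.gdist_triangle C F E
    have h2 := X.gdist_triangle C D F
    have h3 : X.gdist F E = 1 := by rw [gdist, hFE, length_simple]
    have h4 : X.gdist D F + 1 = X.gdist D E := hi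
    have h5 := ih (E := F) (by omega) (by omega)
    rcases X.delta_mem_pair C F E i hFE with h6 | h6
    · rw [h6, h5, hDF, mul_assoc, mul_assoc, cs.simple_mul_simple_self, mul_one]
    · have : X.gdist C E = X.gdist C F := by rw [gdist, h6]; rfl
      omega

/-- Chambers on minimal galleries are determined by their Weyl distance. -/
theorem eq_of_delta_eq {C D D' E : X.Chamber} (h : X.delta C D = X.delta C D')
    (h1 : X.gdist C E = X.gdist C D + X.gdist D E)
    (h2 : X.gdist C E = X.gdist C D' + X.gdist D' E) : D = D' := by
  have h0 : X.delta D E = X.delta D' E := by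
    have h3 := X.delta_eq_mul_of_gdist h1
    rw [X.delta_eq_mul_of_gdist h2, h] at h3
    exact (mul_left_cancel h3).symm
  induction hn : X.gdist D E generalizing E with
  | zero =>
    rw [X.gdist_eq_zero_iff] at hn
    rw [hn, delta_self, eq_comm, delta_eq_one_iff] at h0
    rw [hn, h0]
  | succ n ih =>
    obtain ⟨i, hi⟩ := cs.exists_rightDescent_of_ne_one (w := X.delta D E)
      (by intro h; simp [gdist, h] at hn)
    rw [isRightDescent_iff] at hi
    have key : ∀ G, X.delta G E = X.delta D E → X.gdist C E = X.gdist C G + X.gdist G E →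
        ∃ F, X.delta E F = cs.simple i ∧ X.delta G F = X.delta G E * cs.simple i ∧
          X.delta C F = X.delta C E * cs.simple i ∧ X.gdist C F = X.gdist C G + X.gdist G F ∧
          X.gdist G F = n := by
      intro G hG h
      obtain ⟨F, hEF, hGF⟩ := X.exists_delta G E i
      have h3 := X.gdist_triangle C F E
      have h4 := X.gdist_triangle C G F
      have h5 : X.gdist F E = 1 := by rw [gdist, X.delta_simple_symm hEF, length_simple]
      have h6 : X.gdist G F + 1 = X.gdist G E := by rw [gdist, gdist, hGF, hG]; exact hi
      have h7 : X.gdist G E = X.gdist D E := by rw [gdist, hG]; rfl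
      have h8 : X.gdist C F = X.gdist C G + X.gdist G F := by omega
      refine ⟨F, hEF, hGF, ?_, h8, by omega⟩
      rw [X.delta_eq_mul_of_gdist h8, X.delta_eq_mul_of_gdist h, hGF, mul_assoc]
    obtain ⟨F, hEF, hDF, hCF, hF, hFn⟩ := key D rfl h1
    obtain ⟨F', hEF', hDF', hCF', hF', hFn'⟩ := key D' h0.symm h2
    have hFF : F = F' := by
      have h3 := X.gdist_triangle C F E
      have h5 : X.gdist F E = 1 := by rw [gdist, X.delta_simple_symm hEF, length_simple]
      have h6 : X.gdist C F + 1 = X.gdist C E := by omega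
      rcases X.delta_mem_pair F E F' i hEF' with h | h
      · rwa [X.delta_simple_symm hEF, cs.simple_mul_simple_self, delta_eq_one_iff] at h
      · rw [X.delta_simple_symm hEF] at h
        have h7 := X.delta_eq_of_length C F F' i h (by
          rw [hCF, mul_assoc, cs.simple_mul_simple_self, mul_one, ← hCF]; exact h6.symm)
        rw [hCF', hCF, left_eq_mul] at h7
        rwa [h7, delta_eq_one_iff] at h
    subst hFF
    exact ih hF hF' (by rw [hDF, hDF', h0]) hFn

end Bldg

namespace Bldg

open CoxeterSystem

variable {cs : CoxeterSystem M W} (X : Bldg cs)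

theorem exists_mem_residue_leftMinimal (I : Set B) (C D : X.Chamber) :
    ∃ E ∈ X.residue I C, cs.LeftMinimal (cs.parabolic I) (X.delta E D) := by
  obtain ⟨y, hy, hmin⟩ := cs.exists_leftMinimal_mul (cs.parabolic I) (X.delta C D)
  obtain ⟨E, h1, h2⟩ := X.exists_between (C := C) (E := D) (u := y⁻¹) (v := y * X.delta C D)
    (by simp) (hmin.length_mul (inv_mem hy))
  refine ⟨E, ?_, by rwa [h2]⟩
  change X.delta C E ∈ cs.parabolic I
  rw [h1]; exact inv_mem hy

theorem gdist_add_of_leftMinimal {I : Set B} {D E F : X.Chamber}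
    (hF : X.delta F E ∈ cs.parabolic I) (h : cs.LeftMinimal (cs.parabolic I) (X.delta E D)) :
    X.gdist F D = X.gdist F E + X.gdist E D := by
  have h1 := h.length_mul hF
  rw [gdist, X.delta_eq_mul h1, h1]; rfl

theorem gate_eq_of_forall {R : Set X.Chamber} {D E : X.Chamber} (hE : E ∈ R)
    (h : ∀ F ∈ R, X.gdist D F = X.gdist D E + X.gdist E F) : X.gate R D = E := by
  have hs := Classical.epsilon_spec
    (p := fun G => G ∈ R ∧ ∀ F ∈ R, X.gdist D F = X.gdist D G + X.gdist G F) ⟨E, hE, h⟩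
  change X.gate R D ∈ R ∧ ∀ F ∈ R, X.gdist D F = X.gdist D (X.gate R D) +
    X.gdist (X.gate R D) F at hs
  have h1 := hs.2 E hE
  have h2 := h _ hs.1
  exact (X.gdist_eq_zero_iff).1 (by omega)

theorem gate_eq_of_leftMinimal {I : Set B} {C D E : X.Chamber} (hE : E ∈ X.residue I C)
    (h : cs.LeftMinimal (cs.parabolic I) (X.delta E D)) : X.gate (X.residue I C) D = E := by
  refine X.gate_eq_of_forall hE fun F hF => ?_
  rw [← X.residue_eq hE] at hF
  have := X.gdist_add_of_leftMinimal (X.delta_mem_parabolic_symm hF) h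
  rw [X.gdist_comm D F, X.gdist_comm D E, X.gdist_comm E F]; omega

variable {X}

/-- A spherical type of the spherical residue `R`. -/
def typ (R : X.Res) : Set B := R.2.choose

theorem sphType_typ (R : X.Res) : SphType cs (typ R) := R.2.choose_spec.choose_spec.1

theorem res_nonempty (R : X.Res) : R.1.Nonempty := by
  have h := R.2.choose_spec.choose_spec.2
  exact ⟨R.2.choose_spec.choose, h.ge (X.mem_residue_self _ _)⟩

theorem res_eq_residue {R : X.Res} {C : X.Chamber} (hC : C ∈ R.1) :
    R.1 = X.residue (typ R) C := by
  have h : R.1 = X.residue (typ R) _ := R.2.choose_spec.choose_spec.2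
  rw [h] at hC
  rw [h, X.residue_eq hC]

/-- The standard parabolic subgroup attached to the type of the residue `R`. -/
abbrev Wt (R : X.Res) : Subgroup W := cs.parabolic (typ R)

theorem mem_res_iff {R : X.Res} {C : X.Chamber} (hC : C ∈ R.1) (D : X.Chamber) :
    D ∈ R.1 ↔ X.delta C D ∈ Wt R := by
  rw [res_eq_residue hC]; rfl

theorem delta_mem_Wt {R : X.Res} {C D : X.Chamber} (hC : C ∈ R.1) (hD : D ∈ R.1) :
    X.delta C D ∈ Wt R := (mem_res_iff hC D).1 hD

theorem mem_Wt_iff_of_eq_residue {R : X.Res} {I : Set B} {C : X.Chamber}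
    (h : R.1 = X.residue I C) (x : W) : x ∈ Wt R ↔ x ∈ cs.parabolic I := by
  obtain ⟨D, rfl⟩ := X.exists_delta_eq C x
  rw [← mem_res_iff (R := R) (C := C) (by rw [h]; exact X.mem_residue_self I C) D, h]; rfl

theorem Wt_le_of_subset {R T : X.Res} (h : R.1 ⊆ T.1) : Wt R ≤ Wt T := by
  intro x hx
  obtain ⟨C, hC⟩ := res_nonempty R
  obtain ⟨D, rfl⟩ := X.exists_delta_eq C x
  exact delta_mem_Wt (h hC) (h ((mem_res_iff hC D).2 hx))

theorem subset_of_Wt_le {R T : X.Res} {C : X.Chamber} (hR : C ∈ R.1) (hT : C ∈ T.1)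
    (h : Wt R ≤ Wt T) : R.1 ⊆ T.1 := fun D hD =>
  (mem_res_iff hT D).2 (h ((mem_res_iff hR D).1 hD))

theorem res_eq_of_Wt_eq {R T : X.Res} {C : X.Chamber} (hR : C ∈ R.1) (hT : C ∈ T.1)
    (h : Wt R = Wt T) : R = T :=
  Subtype.ext (Set.Subset.antisymm (subset_of_Wt_le hR hT h.le) (subset_of_Wt_le hT hR h.ge))

theorem Wt_finite (R : X.Res) : ((Wt R : Subgroup W) : Set W).Finite := sphType_typ R

theorem exists_mem_leftMinimal (R : X.Res) (D : X.Chamber) :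
    ∃ E ∈ R.1, cs.LeftMinimal (Wt R) (X.delta E D) := by
  obtain ⟨C, hC⟩ := res_nonempty R
  rw [res_eq_residue hC]
  exact X.exists_mem_residue_leftMinimal _ C D

theorem gate_eq {R : X.Res} {D E : X.Chamber} (hE : E ∈ R.1)
    (h : cs.LeftMinimal (Wt R) (X.delta E D)) : X.gate R.1 D = E := by
  rw [res_eq_residue hE]
  exact X.gate_eq_of_leftMinimal (X.mem_residue_self _ E) h

theorem gate_mem (R : X.Res) (D : X.Chamber) : X.gate R.1 D ∈ R.1 := by
  obtain ⟨E, hE, h⟩ := exists_mem_leftMinimal R D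
  rwa [gate_eq hE h]

theorem leftMinimal_gate (R : X.Res) (D : X.Chamber) :
    cs.LeftMinimal (Wt R) (X.delta (X.gate R.1 D) D) := by
  obtain ⟨E, hE, h⟩ := exists_mem_leftMinimal R D
  rwa [gate_eq hE h]

theorem gdist_gate {R : X.Res} {F : X.Chamber} (hF : F ∈ R.1) (D : X.Chamber) :
    X.gdist F D = X.gdist F (X.gate R.1 D) + X.gdist (X.gate R.1 D) D :=
  X.gdist_add_of_leftMinimal (delta_mem_Wt hF (gate_mem R D)) (leftMinimal_gate R D)

theorem leftMinimal_of_gdist {R : X.Res} {C D E : X.Chamber}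
    (h : cs.LeftMinimal (Wt R) (X.delta C D))
    (hd : X.gdist C D = X.gdist C E + X.gdist E D) : cs.LeftMinimal (Wt R) (X.delta C E) := by
  intro t ht hi
  refine h t ht ?_
  have := X.delta_eq_mul_of_gdist hd
  rw [this]
  refine hi.mul_right ?_
  rw [← this]; exact hd

/-- The residue of type `I`, for `I` spherical, through the chamber `C`. -/
def mkRes {I : Set B} (hI : SphType cs I) (C : X.Chamber) : X.Res := ⟨X.residue I C, I, C, hI, rfl⟩

theorem mem_mkRes {I : Set B} (hI : SphType cs I) (C : X.Chamber) : C ∈ (mkRes hI C).1 :=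
  X.mem_residue_self I C

theorem Wt_mkRes {I : Set B} (hI : SphType cs I) (C : X.Chamber) :
    Wt (mkRes hI C) = cs.parabolic I := by
  ext x; exact mem_Wt_iff_of_eq_residue rfl x

theorem projSet_eq_residue {R T : X.Res} {C D : X.Chamber} (hC : C ∈ R.1) (hD : D ∈ T.1)
    (hCD : cs.LeftMinimal (Wt R) (X.delta C D)) (hDC : cs.LeftMinimal (Wt T) (X.delta D C)) :
    X.projSet R.1 T.1 =
      X.residue {i | i ∈ typ R ∧ (X.delta C D)⁻¹ * cs.simple i * X.delta C D ∈ Wt T} C := by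
  set w := X.delta C D with hw
  ext E
  have hK : E ∈ X.residue {i | i ∈ typ R ∧ w⁻¹ * cs.simple i * w ∈ Wt T} C ↔
      X.delta C E ∈ Wt R ∧ w⁻¹ * X.delta C E * w ∈ Wt T := mem_parabolic_inter_iff hCD _
  rw [hK]
  constructor
  · rintro ⟨D', hD', rfl⟩
    obtain ⟨x, hx, hxT, hmin⟩ := exists_leftMinimal_of_mem_parabolic hCD
      (X.delta_inv_mul_mem (delta_mem_Wt hD hD') C)
    rw [← hw, mul_inv_cancel_left] at hmin
    obtain ⟨E, h1, h2⟩ := X.exists_between (C := C) (E := D') (u := x⁻¹) (v := x * X.delta C D')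
      (by simp) (hmin.length_mul (inv_mem hx))
    have hE : E ∈ R.1 := (mem_res_iff hC E).2 (by rw [h1]; exact inv_mem hx)
    rw [gate_eq hE (by rwa [h2]), h1]
    refine ⟨inv_mem hx, ?_⟩
    have := inv_mem hxT
    simpa [mul_assoc] using this
  · rintro ⟨h1, h2⟩
    have h3 := X.gdist_add_of_leftMinimal (X.delta_mem_parabolic_symm h1) hCD
    have h4 := X.delta_eq_mul_of_gdist h3
    rw [← X.delta_inv C E] at h4
    have hy : w⁻¹ * (X.delta C E)⁻¹ * w ∈ Wt T := by
      have := inv_mem h2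
      simpa [mul_assoc] using this
    rw [← delta_inv, ← hw] at hDC
    obtain ⟨D', h5, h6⟩ := X.exists_between (C := E) (E := D) (u := w)
      (v := w⁻¹ * (X.delta C E)⁻¹ * w) (by rw [h4, ← hw]; simp [mul_assoc]) (hDC.length_mul_inv hy)
    have hE : E ∈ R.1 := (mem_res_iff hC E).2 h1
    refine ⟨D', (mem_res_iff hD D').2 (X.delta_mem_parabolic_symm (by rwa [h6])), ?_⟩
    exact gate_eq hE (by rwa [h5])

theorem exists_minimal_pair (R T : X.Res) : ∃ C ∈ R.1, ∃ D ∈ T.1,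
    cs.LeftMinimal (Wt R) (X.delta C D) ∧ cs.LeftMinimal (Wt T) (X.delta D C) := by
  obtain ⟨D, hD⟩ := res_nonempty T
  refine ⟨_, gate_mem R D, _, gate_mem T (X.gate R.1 D), ?_, leftMinimal_gate _ _⟩
  apply leftMinimal_of_gdist (leftMinimal_gate R D)
  have := gdist_gate hD (X.gate R.1 D)
  rw [X.gdist_comm, this, X.gdist_comm D, add_comm, X.gdist_comm (X.gate T.1 _) (X.gate R.1 D)]

theorem SphType.mono {I J : Set B} (h : SphType cs J) (hI : I ⊆ J) : SphType cs I :=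
  Set.Finite.subset h (Subgroup.closure_mono (Set.image_mono hI))

theorem projRes_val (R T : X.Res) : (X.projRes R T).1 = X.projSet R.1 T.1 := by
  refine Classical.epsilon_spec (p := fun U : X.Res => U.1 = X.projSet R.1 T.1) ?_
  obtain ⟨C, hC, D, hD, h1, h2⟩ := exists_minimal_pair R T
  exact ⟨⟨_, _, C, SphType.mono (sphType_typ R) (fun i hi => hi.1), rfl⟩,
    (projSet_eq_residue hC hD h1 h2).symm⟩

theorem projRes_subset (R T : X.Res) : (X.projRes R T).1 ⊆ R.1 := by
  rw [projRes_val]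
  rintro _ ⟨D, -, rfl⟩
  exact gate_mem R D

theorem gate_mem_projRes (R : X.Res) {T : X.Res} {D : X.Chamber} (hD : D ∈ T.1) :
    X.gate R.1 D ∈ (X.projRes R T).1 := by
  rw [projRes_val]; exact ⟨D, hD, rfl⟩

theorem mem_projRes {R T : X.Res} {C D : X.Chamber} (hC : C ∈ R.1) (hD : D ∈ T.1)
    (hCD : cs.LeftMinimal (Wt R) (X.delta C D)) : C ∈ (X.projRes R T).1 := by
  rw [← gate_eq hC hCD]; exact gate_mem_projRes R hD

theorem mem_Wt_projRes_iff {R T : X.Res} {C D : X.Chamber} (hC : C ∈ R.1) (hD : D ∈ T.1)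
    (hCD : cs.LeftMinimal (Wt R) (X.delta C D)) (x : W) :
    x ∈ Wt (X.projRes R T) ↔ x ∈ Wt R ∧ (X.delta C D)⁻¹ * x * X.delta C D ∈ Wt T := by
  have hE := gate_mem T C
  have hd := gdist_gate hD C
  rw [X.gdist_comm, X.gdist_comm D, add_comm, X.gdist_comm (X.gate T.1 C) C] at hd
  have hCE := leftMinimal_of_gdist hCD hd
  have h1 := projSet_eq_residue hC hE hCE (leftMinimal_gate T C)
  rw [← projRes_val] at h1
  rw [mem_Wt_iff_of_eq_residue h1, mem_parabolic_inter_iff hCE]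
  have hv := delta_mem_Wt hE hD
  rw [X.delta_eq_mul_of_gdist hd]
  refine and_congr_right fun _ => ?_
  set a := X.delta C (X.gate T.1 C)
  set b := X.delta (X.gate T.1 C) D
  constructor
  · intro h
    have := mul_mem (mul_mem (inv_mem hv) h) hv
    simpa [mul_assoc] using this
  · intro h
    have := mul_mem (mul_mem hv h) (inv_mem hv)
    simpa [mul_assoc] using this

end Bldg

namespace Bldg

open CoxeterSystem

variable {cs : CoxeterSystem M W} (X : Bldg cs)

theorem length_mul_lt_of_isLeftDescent {i : B} {u v : W} (hu : cs.IsRightDescent u i)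
    (hv : cs.IsLeftDescent v i) : cs.length (u * v) < cs.length (u * (cs.simple i * v)) := by
  have ht : cs.IsReflection (u * cs.simple i * u⁻¹) := (cs.isReflection_simple i).conj u
  have h1 : cs.IsLeftInversion u (u * cs.simple i * u⁻¹) := ⟨ht, by
    rw [inv_mul_cancel_right]; exact hu⟩
  have h2 : ¬ cs.IsLeftInversion (cs.simple i * v) (u⁻¹ * (u * cs.simple i * u⁻¹) * u) := by
    rintro ⟨-, h⟩
    rw [isLeftDescent_iff] at hv
    simp [mul_assoc] at h
    omega
  have h3 := cs.isLeftInversion_mul_iff ht u (cs.simple i * v)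
  have h4 : cs.IsLeftInversion (u * (cs.simple i * v)) (u * cs.simple i * u⁻¹) := by tauto
  have := h4.2
  simpa [mul_assoc] using this

theorem exists_adj_of_isLeftDescent {C D : X.Chamber} {i : B}
    (h : cs.IsLeftDescent (X.delta C D) i) :
    ∃ E, X.delta C E = cs.simple i ∧ X.delta E D = cs.simple i * X.delta C D := by
  rw [isLeftDescent_iff] at h
  refine X.exists_between (u := cs.simple i) (v := cs.simple i * X.delta C D) (by simp) ?_
  rw [cs.simple_mul_simple_cancel_left, length_simple]; omega

theorem length_delta_mul_le (C D E : X.Chamber) :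
    cs.length (X.delta C D * X.delta D E) ≤ X.gdist C E := by
  induction hn : X.gdist D E generalizing D with
  | zero => rw [(X.gdist_eq_zero_iff).1 hn, delta_self, mul_one]; exact le_rfl
  | succ n ih =>
    obtain ⟨i, hi⟩ := cs.exists_leftDescent_of_ne_one (w := X.delta D E)
      (by intro h; simp [gdist, h] at hn)
    obtain ⟨F, hDF, hFE⟩ := X.exists_adj_of_isLeftDescent hi
    have hi' := (cs.isLeftDescent_iff).1 hi
    rw [← hFE] at hi'
    have h1 := ih F (by unfold gdist at *; omega)
    rcases X.delta_mem_pair C D F i hDF with h | h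
    · rwa [h, hFE, mul_assoc, cs.simple_mul_simple_cancel_left] at h1
    · by_cases hd : cs.IsRightDescent (X.delta C D) i
      · have h2 := length_mul_lt_of_isLeftDescent hd hi
        rw [h, hFE] at h1
        omega
      · rw [not_isRightDescent_iff] at hd
        have := X.delta_eq_of_length C D F i hDF hd
        rwa [this, hFE, mul_assoc, cs.simple_mul_simple_cancel_left] at h1

/-- Adjacency transfers along galleries on which the Weyl distance is multiplicative and that
do not leave a root. -/
theorem delta_adj_eq {C E D₁ D : X.Chamber} {i : B} (hCE : X.delta C E = cs.simple i)
    (h1 : cs.IsLeftDescent (X.delta C D₁) i) (h2 : cs.IsLeftDescent (X.delta C D) i)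
    (hE : X.delta E D₁ = cs.simple i * X.delta C D₁)
    (hm : X.delta C D = X.delta C D₁ * X.delta D₁ D) :
    X.delta E D = cs.simple i * X.delta C D := by
  induction hn : X.gdist D₁ D generalizing D₁ with
  | zero => rwa [(X.gdist_eq_zero_iff).1 hn] at hE
  | succ n ih =>
    obtain ⟨j, hj⟩ := cs.exists_leftDescent_of_ne_one (w := X.delta D₁ D)
      (by intro h; simp [gdist, h] at hn)
    obtain ⟨F, hF, hFD⟩ := X.exists_adj_of_isLeftDescent hj
    have hj' := (cs.isLeftDescent_iff).1 hj
    have hCF : X.delta C F = X.delta C D₁ * cs.simple j := by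
      rcases X.delta_mem_pair C D₁ F j hF with h | h
      · exact h
      · by_cases hd : cs.IsRightDescent (X.delta C D₁) j
        · have h3 := length_mul_lt_of_isLeftDescent hd hj
          have h4 := X.length_delta_mul_le C F D
          rw [h, hFD] at h4
          rw [gdist, hm] at h4
          omega
        · exact X.delta_eq_of_length C D₁ F j hF ((cs.not_isRightDescent_iff).1 hd)
    have hr := cs.isReflection_simple i
    have hFneg : cs.IsLeftInversion (X.delta C D₁ * cs.simple j) (cs.simple i) := by
      by_contra hc
      have h3 := cs.isLeftInversion_mul_iff hr (X.delta C D₁) (cs.simple j)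
      have h4 : cs.IsLeftInversion (X.delta C D₁) (cs.simple i) := ⟨hr, h1⟩
      have h5 : cs.IsLeftInversion (cs.simple j)
        ((X.delta C D₁)⁻¹ * cs.simple i * X.delta C D₁) := by tauto
      rw [isLeftInversion_simple_iff] at h5
      have h6 := cs.isLeftInversion_mul_iff hr (X.delta C D₁ * cs.simple j)
        (cs.simple j * X.delta D₁ D)
      rw [mul_assoc, cs.simple_mul_simple_cancel_left, ← hm] at h6
      have h7 : cs.IsLeftInversion (X.delta C D) (cs.simple i) := ⟨hr, h2⟩
      have h8 : cs.IsLeftInversion (cs.simple j * X.delta D₁ D) (cs.simple j) := by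
        have h9 : (X.delta C D₁ * cs.simple j)⁻¹ * cs.simple i * (X.delta C D₁ * cs.simple j) =
            cs.simple j := by
          rw [mul_inv_rev, mul_assoc, mul_assoc, ← mul_assoc (cs.simple i),
            ← mul_assoc (X.delta C D₁)⁻¹, ← mul_assoc (X.delta C D₁)⁻¹, h5]
          simp
        rw [h9] at h6
        tauto
      have h9 := h8.2
      rw [cs.simple_mul_simple_cancel_left] at h9
      omega
    have hFneg' : cs.IsLeftDescent (X.delta C F) i := by rw [hCF]; exact hFneg.2
    refine ih hFneg' ?_ (by rw [hCF, hFD, mul_assoc, cs.simple_mul_simple_cancel_left, ← hm])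
      (by unfold gdist at *; rw [hFD]; omega)
    obtain ⟨E', hCE', hE'F⟩ := X.exists_adj_of_isLeftDescent hFneg'
    have hEE' : X.delta E E' = 1 ∨ X.delta E E' = cs.simple i := by
      have := X.delta_mem_pair E C E' i hCE'
      rwa [X.delta_simple_symm hCE, cs.simple_mul_simple_self] at this
    rcases hEE' with h | h
    · rw [(X.delta_eq_one_iff _ _).1 h, hE'F]
    · exfalso
      have h3 : X.delta E F = X.delta C F := by
        have h4 : X.delta E E' * X.delta E' F = X.delta C F := by
          rw [h, hE'F, cs.simple_mul_simple_cancel_left]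
        rw [← h4]
        refine X.delta_eq_mul ?_
        rw [h4, h, hE'F, length_simple]
        have := (cs.isLeftDescent_iff).1 hFneg'
        omega
      rw [hCF] at h3 hFneg'
      have h5 := (cs.isLeftDescent_iff).1 hFneg'
      have h6 := (cs.isLeftDescent_iff).1 h1
      rcases X.delta_mem_pair E D₁ F j hF with h4 | h4
      · rw [h4, hE, mul_assoc] at h3
        simp only [mul_eq_right] at h3
        rw [h3, one_mul] at h6
        omega
      · rw [h4, hE] at h3
        rw [← h3, cs.simple_mul_simple_cancel_left] at h5
        omega

/-- Partial isometries of `W` into a building extend to apartment maps. -/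
theorem exists_isApartMap_extending {G₀ : Set (W × X.Chamber)} (hne : G₀.Nonempty)
    (h₀ : ∀ p ∈ G₀, ∀ q ∈ G₀, X.delta p.2 q.2 = p.1⁻¹ * q.1) :
    ∃ α : W → X.Chamber, X.IsApartMap α ∧ ∀ p ∈ G₀, α p.1 = p.2 := by
  obtain ⟨G, hsub, hG⟩ := zorn_subset_nonempty
    {G : Set (W × X.Chamber) | ∀ p ∈ G, ∀ q ∈ G, X.delta p.2 q.2 = p.1⁻¹ * q.1} (by
      intro c hc hchain _
      refine ⟨⋃₀ c, ?_, fun s hs => Set.subset_sUnion_of_mem hs⟩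
      rintro p ⟨s, hs, hp⟩ q ⟨s', hs', hq⟩
      rcases hchain.total hs hs' with h | h
      · exact hc hs' p (h hp) q hq
      · exact hc hs p hp q (h hq)) G₀ h₀
  have hGp : ∀ p ∈ G, ∀ q ∈ G, X.delta p.2 q.2 = p.1⁻¹ * q.1 := hG.1
  have hstep : ∀ p ∈ G, ∀ i, ∃ E, (p.1 * cs.simple i, E) ∈ G := by
    intro p hp i
    have hE : ∃ E, X.delta p.2 E = cs.simple i ∧
        ∀ q ∈ G, X.delta E q.2 = cs.simple i * X.delta p.2 q.2 := by
      have hpos : ∀ E, X.delta p.2 E = cs.simple i → ∀ q : W × X.Chamber,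
          ¬ cs.IsLeftDescent (X.delta p.2 q.2) i →
            X.delta E q.2 = cs.simple i * X.delta p.2 q.2 := by
        intro E hE q hq
        have hE' := X.delta_simple_symm hE
        rw [not_isLeftDescent_iff] at hq
        rw [← hE']
        refine X.delta_eq_mul ?_
        rw [hE', length_simple]; omega
      by_cases hex : ∃ q ∈ G, cs.IsLeftDescent (X.delta p.2 q.2) i
      · obtain ⟨q₁, hq₁, hd⟩ := hex
        obtain ⟨E, hE, hEq⟩ := X.exists_adj_of_isLeftDescent hd
        refine ⟨E, hE, fun q hq => ?_⟩
        by_cases hqd : cs.IsLeftDescent (X.delta p.2 q.2) i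
        · refine X.delta_adj_eq hE hd hqd hEq ?_
          rw [hGp p hp q hq, hGp p hp q₁ hq₁, hGp q₁ hq₁ q hq]
          simp [mul_assoc]
        · exact hpos E hE q hqd
      · push Not at hex
        obtain ⟨E, hE, -⟩ := X.exists_delta p.2 p.2 i
        exact ⟨E, hE, fun q hq => hpos E hE q (hex q hq)⟩
    obtain ⟨E, hE, hEq⟩ := hE
    have hEq' : ∀ q ∈ G, X.delta E q.2 = (p.1 * cs.simple i)⁻¹ * q.1 := by
      intro q hq
      rw [hEq q hq, hGp p hp q hq, mul_inv_rev, inv_simple, mul_assoc]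
    refine ⟨E, hG.2 (y := insert (p.1 * cs.simple i, E) G) ?_ (Set.subset_insert _ _)
      (Set.mem_insert _ _)⟩
    rintro a (rfl | ha) b (rfl | hb)
    · simp
    · exact hEq' b hb
    · rw [← delta_inv, hEq' a ha]; simp
    · exact hGp a ha b hb
  have htot : ∀ w, ∃ E, (w, E) ∈ G := by
    obtain ⟨p, hp⟩ := hne
    have : ∀ w, ∃ E, (p.1 * w, E) ∈ G := by
      intro w
      induction w using cs.simple_induction_right with
      | one => exact ⟨p.2, by simpa using hsub hp⟩
      | mul_simple_right w i ih =>
        obtain ⟨E, hE⟩ := ih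
        obtain ⟨F, hF⟩ := hstep _ hE i
        exact ⟨F, by rwa [← mul_assoc]⟩
    intro w
    simpa using this (p.1⁻¹ * w)
  choose α hα using htot
  have hd : ∀ v w, X.delta (α v) (α w) = v⁻¹ * w := fun v w => hGp _ (hα v) _ (hα w)
  refine ⟨α, ⟨fun v w h => ?_, hd⟩, fun p hp => ?_⟩
  · have := hd v w
    rw [h, delta_self] at this
    exact inv_mul_eq_one.1 this.symm
  · have := hGp _ (hα p.1) _ (hsub hp)
    rwa [inv_mul_cancel, delta_eq_one_iff] at this

theorem exists_isApartMap {C D E : X.Chamber}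
    (h : X.gdist C D = X.gdist C E + X.gdist E D) :
    ∃ α : W → X.Chamber, X.IsApartMap α ∧
      α 1 = C ∧ α (X.delta C E) = E ∧ α (X.delta C D) = D := by
  have h1 := X.delta_eq_mul_of_gdist h
  obtain ⟨α, hα, h⟩ := X.exists_isApartMap_extending
    (G₀ := {(1, C), (X.delta C E, E), (X.delta C D, D)}) ⟨_, Set.mem_insert _ _⟩ (by
      rintro p (rfl | rfl | rfl) q (rfl | rfl | rfl)
      all_goals simp [h1]
      all_goals simp [← delta_inv X C E, ← delta_inv X E D, ← delta_inv X C D, h1])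
  exact ⟨α, hα, h (1, C) (by simp), h (_, E) (by simp), h (_, D) (by simp)⟩

variable {X}

theorem IsApartMap.eq_of_gdist {α : W → X.Chamber} (hα : X.IsApartMap α) {u v : W}
    {E : X.Chamber} (h : X.gdist (α u) (α v) = X.gdist (α u) E + X.gdist E (α v)) :
    α (u * X.delta (α u) E) = E := by
  have h1 := X.delta_eq_mul_of_gdist h
  rw [hα.2] at h1
  have h2 : X.delta (α u) (α (u * X.delta (α u) E)) = X.delta (α u) E := by
    rw [hα.2]; simp
  have h3 : X.delta (α (u * X.delta (α u) E)) (α v) = X.delta E (α v) := by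
    rw [hα.2, mul_inv_rev, mul_assoc, h1]; simp
  refine X.eq_of_delta_eq h2 (E := α v) ?_ h
  rw [h]
  unfold gdist
  rw [h2, h3]

theorem IsApartMap.gate_mem_range {α : W → X.Chamber} (hα : X.IsApartMap α) {R : X.Res} {u : W}
    (hu : α u ∈ R.1) (v : W) : ∃ c, α c = X.gate R.1 (α v) :=
  ⟨_, hα.eq_of_gdist (gdist_gate hu (α v))⟩

end Bldg

namespace Bldg

open CoxeterSystem

variable {cs : CoxeterSystem M W} {X : Bldg cs}

theorem leftMinimal_gate_gate (R : X.Res) {T : X.Res} {D : X.Chamber} (hD : D ∈ T.1) :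
    cs.LeftMinimal (Wt R) (X.delta (X.gate R.1 D) (X.gate T.1 (X.gate R.1 D))) := by
  apply leftMinimal_of_gdist (leftMinimal_gate R D)
  have := gdist_gate hD (X.gate R.1 D)
  rw [X.gdist_comm, this, X.gdist_comm D, add_comm, X.gdist_comm (X.gate T.1 _) (X.gate R.1 D)]

theorem sep_iff_not_sep {a b c t : W} (h : cs.Sep t a b) : cs.Sep t a c ↔ ¬ cs.Sep t b c := by
  have := h.1
  have := h.2
  unfold CoxeterSystem.Sep
  tauto

theorem not_sep_trans {a b c t : W} (h : ¬ cs.Sep t a b) : cs.Sep t a c ↔ cs.Sep t b c := by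
  unfold CoxeterSystem.Sep at *
  tauto

theorem sep_mul_simple {c t : W} {i : B} (h : cs.Sep t c (c * cs.simple i)) :
    t = c * cs.simple i * c⁻¹ := by
  have h1 := (sep_iff h.1 c (c * cs.simple i)).1 h
  rw [inv_mul_cancel_left, isLeftInversion_simple_iff] at h1
  rw [← h1]; simp [mul_assoc]

theorem sep_self_mul {t : W} (ht : cs.IsReflection t) (c : W) : cs.Sep t c (t * c) := by
  refine ⟨ht, fun h => ?_⟩
  have h1 := ht.mul_self
  simp only [IsLeftInversion, ht, true_and, ← mul_assoc, h1, one_mul] at h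
  have := ht.length_mul_right_ne c
  omega

/-- The side containing `α c` of the wall of the reflection `t`, in the apartment given by `α`. -/
def side (α : W → X.Chamber) (c t : W) : Set X.Chamber := α '' {v | ¬ cs.Sep t c v}

theorem side_eq_of_not_sep (α : W → X.Chamber) {a b t : W} (h : ¬ cs.Sep t a b) :
    side α a t = side α b t := by
  unfold side
  simp_rw [not_sep_trans h]

namespace IsApartMap

variable {α : W → X.Chamber}

theorem mem_side_iff (hα : X.IsApartMap α) {c t v : W} : α v ∈ side α c t ↔ ¬ cs.Sep t c v :=
  hα.1.mem_set_image

theorem comp_mul_left (hα : X.IsApartMap α) (u : W) : X.IsApartMap fun v => α (u * v) :=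
  ⟨fun v w h => mul_left_cancel (hα.1 h), fun v w => by rw [hα.2]; simp [mul_assoc]⟩

theorem exists_eq_comp_mul_left (hα : X.IsApartMap α) {α' : W → X.Chamber} (hα' : X.IsApartMap α')
    (h : Set.range α = Set.range α') : ∃ u, ∀ v, α' v = α (u * v) := by
  obtain ⟨u, hu⟩ : α' 1 ∈ Set.range α := by rw [h]; exact ⟨1, rfl⟩
  refine ⟨u, fun v => ?_⟩
  obtain ⟨w, hw⟩ : α' v ∈ Set.range α := by rw [h]; exact ⟨v, rfl⟩
  have h1 := hα'.2 1 v
  rw [← hu, ← hw, hα.2, inv_one, one_mul] at h1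
  rw [← hw, ← h1]; simp

theorem isRootOf_side (hα : X.IsApartMap α) {t : W} (ht : cs.IsReflection t) (c : W) :
    X.IsRootOf (Set.range α) (side α c t) := by
  refine ⟨_, hα.comp_mul_left c, ?_, c⁻¹ * t * c, isReflection_conj_inv ht c, ?_⟩
  · exact ((mul_left_surjective c).range_comp α).symm
  · have hset : {v | ¬ cs.Sep t c v} =
        (fun v => c * v) '' {v | cs.length v < cs.length (c⁻¹ * t * c * v)} := by
      ext v
      simp only [Set.mem_ofPred_eq, Set.image_mul_left, Set.mem_preimage, sep_iff ht]
      have h1 := (isReflection_conj_inv ht c).length_mul_right_ne (c⁻¹ * v)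
      have h2 := isReflection_conj_inv ht c
      simp only [IsLeftInversion, h2, true_and]
      omega
    rw [side, hset, Set.image_image]

theorem exists_eq_side (hα : X.IsApartMap α) {φ : Set X.Chamber} (h : X.IsRootOf (Set.range α) φ) :
    ∃ t c, cs.IsReflection t ∧ φ = side α c t := by
  obtain ⟨α', hα', hr, t, ht, rfl⟩ := h
  obtain ⟨u, hu⟩ := hα.exists_eq_comp_mul_left hα' hr
  refine ⟨u * t * u⁻¹, u, ht.conj u, ?_⟩
  have hset : {v | ¬ cs.Sep (u * t * u⁻¹) u v} =
      (fun v => u * v) '' {v | cs.length v < cs.length (t * v)} := by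
    ext v
    simp only [Set.mem_ofPred_eq, Set.image_mul_left, Set.mem_preimage, sep_conj_iff ht]
    have h1 := ht.length_mul_right_ne (u⁻¹ * v)
    simp only [IsLeftInversion, ht, true_and]
    omega
  rw [side, hset, Set.image_image]
  simp_rw [hu]

theorem side_injOn (hα : X.IsApartMap α)
    (c : W) : Set.InjOn (side α c) {t | cs.IsReflection t} := by
  intro t ht t' ht' h
  have h1 : ∀ v, cs.Sep t c v ↔ cs.Sep t' c v := by
    intro v
    have := Set.ext_iff.1 h (α v)
    rw [hα.mem_side_iff, hα.mem_side_iff] at this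
    tauto
  obtain ⟨u, i, rfl⟩ := ht
  have h2 : cs.Sep (u * cs.simple i * u⁻¹) u (u * cs.simple i) := by
    rw [sep_conj_iff (cs.isReflection_simple i), inv_mul_cancel_left, isLeftInversion_simple_iff]
  refine (sep_mul_simple (c := u) (i := i) ⟨ht', ?_⟩).symm
  have h3 := h1 u
  have h4 := h1 (u * cs.simple i)
  have h5 := h2.1
  have h6 := h2.2
  have h7 : cs.IsReflection t' := ht'
  unfold CoxeterSystem.Sep at h3 h4
  tauto

theorem mem_iff (hα : X.IsApartMap α)
    {R : X.Res} {c : W} (hc : α c ∈ R.1) (v : W) : α v ∈ R.1 ↔ c⁻¹ * v ∈ Wt R := by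
  rw [mem_res_iff hc, hα.2]

end IsApartMap

/-- The wall of the reflection `t` in the apartment given by `α` crosses the residue `R`. -/
def Cross (α : W → X.Chamber) (t : W) (R : X.Res) : Prop :=
  ∃ v w, α v ∈ R.1 ∧ α w ∈ R.1 ∧ cs.Sep t v w

/-- The number of reflections of a residue. -/
def reflNum (R : X.Res) : ℕ := {t | cs.IsReflection t ∧ t ∈ Wt R}.ncard

theorem Cross.isReflection {α : W → X.Chamber} {t : W} {R : X.Res} (h : Cross α t R) :
    cs.IsReflection t := by
  obtain ⟨v, w, -, -, h⟩ := h
  exact h.1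

namespace IsApartMap

variable {α : W → X.Chamber}

theorem cross_iff (hα : X.IsApartMap α) {R : X.Res} {c t : W} (hc : α c ∈ R.1) :
    Cross α t R ↔ cs.IsReflection t ∧ c⁻¹ * t * c ∈ Wt R := by
  constructor
  · rintro ⟨v, w, hv, hw, h⟩
    refine ⟨h.1, ?_⟩
    have h1 := (hα.mem_iff hc v).1 hv
    have h2 := (hα.mem_iff hv w).1 hw
    have h3 := mul_mem (mul_mem h1 (h.conj_mem_parabolic h2)) (inv_mem h1)
    simpa [mul_assoc] using h3
  · rintro ⟨ht, h⟩
    refine ⟨c, t * c, hc, (hα.mem_iff hc _).2 (by rwa [← mul_assoc]), sep_self_mul ht c⟩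

theorem setOf_cross_eq (hα : X.IsApartMap α) {R : X.Res} {c : W} (hc : α c ∈ R.1) :
    {t | Cross α t R} = (fun t => c * t * c⁻¹) '' {t | cs.IsReflection t ∧ t ∈ Wt R} := by
  ext t
  simp only [Set.mem_ofPred_eq, Set.mem_image, hα.cross_iff hc]
  constructor
  · rintro ⟨h1, h2⟩
    exact ⟨_, ⟨isReflection_conj_inv h1 c, h2⟩, by simp [mul_assoc]⟩
  · rintro ⟨x, ⟨h1, h2⟩, rfl⟩
    exact ⟨h1.conj c, by simpa [mul_assoc] using h2⟩

theorem cross_finite (hα : X.IsApartMap α)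
    {R : X.Res} {c : W} (hc : α c ∈ R.1) : {t | Cross α t R}.Finite := by
  rw [hα.setOf_cross_eq hc]
  exact ((Wt_finite R).subset fun t ht => ht.2).image _

theorem ncard_cross (hα : X.IsApartMap α) {R : X.Res} {c : W} (hc : α c ∈ R.1) :
    {t | Cross α t R}.ncard = reflNum R := by
  rw [hα.setOf_cross_eq hc, Set.ncard_image_of_injective, reflNum]
  intro a b h
  simpa using h

theorem containedInRoot_side_iff (hα : X.IsApartMap α) {R : X.Res} {c d t : W} (hd : α d ∈ R.1) :
    X.ContainedInRoot R (Set.range α) (side α c t) ↔ ¬ Cross α t R ∧ ¬ cs.Sep t c d := by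
  constructor
  · intro h
    have h' : ∀ v, α v ∈ R.1 → ¬ cs.Sep t c v := fun v hv =>
      hα.mem_side_iff.1 (h ⟨hv, v, rfl⟩)
    refine ⟨?_, h' d hd⟩
    rintro ⟨v, w, hv, hw, hs⟩
    have := (not_sep_trans (h' v hv)).not.1 (h' w hw)
    exact this hs
  · rintro ⟨h1, h2⟩ _ ⟨hv, v, rfl⟩
    rw [hα.mem_side_iff, not_sep_trans h2]
    exact fun hs => h1 ⟨d, v, hd, hv, hs⟩

theorem phiSep_eq (hα : X.IsApartMap α)
    {R₁ R₂ : X.Res} {c d : W} (hc : α c ∈ R₁.1) (hd : α d ∈ R₂.1) :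
    X.PhiSep (Set.range α) R₁ R₂ =
      side α c '' {t | cs.IsReflection t ∧ ¬ Cross α t R₁ ∧ (Cross α t R₂ ∨ cs.Sep t c d)} := by
  ext φ
  constructor
  · rintro ⟨hφ, h1, h2⟩
    obtain ⟨t, u, ht, rfl⟩ := hα.exists_eq_side hφ
    rw [hα.containedInRoot_side_iff hc] at h1
    rw [hα.containedInRoot_side_iff hd] at h2
    have h3 := not_sep_trans (c := d) h1.2
    exact ⟨t, ⟨ht, h1.1, by tauto⟩, (side_eq_of_not_sep α h1.2).symm⟩
  · rintro ⟨t, ⟨ht, h1, h2⟩, rfl⟩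
    refine ⟨hα.isRootOf_side ht c, ?_, ?_⟩
    · rw [hα.containedInRoot_side_iff hc]
      exact ⟨h1, fun h => h.2 Iff.rfl⟩
    · rw [hα.containedInRoot_side_iff hd]
      tauto

theorem phiSep_finite (hα : X.IsApartMap α)
    {R₁ R₂ : X.Res} {c d : W} (hc : α c ∈ R₁.1) (hd : α d ∈ R₂.1) :
    (X.PhiSep (Set.range α) R₁ R₂).Finite := by
  rw [hα.phiSep_eq hc hd]
  refine Set.Finite.image _ (((hα.cross_finite hd).union (cs.sep_finite c d)).subset ?_)
  rintro t ⟨-, -, h⟩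
  exact h

theorem not_cross_of_sep (hα : X.IsApartMap α) {R : X.Res} {c d t : W} (hc : α c ∈ R.1)
    (hmin : cs.LeftMinimal (Wt R) (c⁻¹ * d)) (h : cs.Sep t c d) : ¬ Cross α t R := by
  rw [hα.cross_iff hc]
  exact fun h' => hmin.not_sep h'.2 h

theorem ncard_phiSep (hα : X.IsApartMap α)
    {R₁ R₂ : X.Res} {c d : W} (hc : α c ∈ R₁.1) (hd : α d ∈ R₂.1)
    (h1 : cs.LeftMinimal (Wt R₁) (c⁻¹ * d)) (h2 : cs.LeftMinimal (Wt R₂) (d⁻¹ * c)) :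
    (X.PhiSep (Set.range α) R₁ R₂).ncard + {t | Cross α t R₁ ∧ Cross α t R₂}.ncard =
      cs.length (c⁻¹ * d) + reflNum R₂ := by
  rw [hα.phiSep_eq hc hd, Set.InjOn.ncard_image ((hα.side_injOn c).mono fun t ht => ht.1)]
  have hset : {t | cs.IsReflection t ∧ ¬ Cross α t R₁ ∧ (Cross α t R₂ ∨ cs.Sep t c d)} =
      {t | cs.Sep t c d} ∪ ({t | Cross α t R₂} \ {t | Cross α t R₁ ∧ Cross α t R₂}) := by
    ext t
    have h3 : cs.Sep t c d → ¬ Cross α t R₁ := hα.not_cross_of_sep hc h1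
    have h4 : cs.Sep t c d → cs.IsReflection t := fun h => h.1
    have h5 : Cross α t R₂ → cs.IsReflection t := fun h => h.isReflection
    simp only [Set.mem_ofPred_eq, Set.mem_union, Set.mem_sdiff]
    tauto
  have hfin := hα.cross_finite hd
  rw [hset, Set.ncard_union_eq _ (cs.sep_finite c d) (hfin.sdiff), ncard_sep, add_assoc,
    Set.ncard_sdiff_add_ncard_of_subset (fun t ht => ht.2) hfin, hα.ncard_cross hd]
  rw [Set.disjoint_left]
  intro t ht ht'
  exact hα.not_cross_of_sep hd h2 ht.symm ht'.1

theorem ncard_cross_and (hα : X.IsApartMap α)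
    {R₁ R₂ : X.Res} {c d : W} (hc : α c ∈ R₁.1) (hd : α d ∈ R₂.1)
    (h1 : cs.LeftMinimal (Wt R₁) (c⁻¹ * d)) :
    {t | Cross α t R₁ ∧ Cross α t R₂}.ncard = reflNum (X.projRes R₁ R₂) := by
  rw [← hα.2] at h1
  have hP := mem_projRes hc hd h1
  rw [← hα.ncard_cross hP]
  congr 1
  ext t
  simp only [Set.mem_ofPred_eq]
  rw [hα.cross_iff hc, hα.cross_iff hd, hα.cross_iff hP, mem_Wt_projRes_iff hc hd h1, hα.2]
  have : (c⁻¹ * d)⁻¹ * (c⁻¹ * t * c) * (c⁻¹ * d) = d⁻¹ * t * d := by simp [mul_assoc]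
  rw [this]
  tauto

theorem exists_minimal_pair (hα : X.IsApartMap α)
    {R₁ R₂ : X.Res} {a b : W} (ha : α a ∈ R₁.1) (hb : α b ∈ R₂.1) :
    ∃ c d, α c ∈ R₁.1 ∧ α d ∈ R₂.1 ∧ cs.LeftMinimal (Wt R₁) (c⁻¹ * d) ∧
      cs.LeftMinimal (Wt R₂) (d⁻¹ * c) := by
  obtain ⟨c, hc⟩ := hα.gate_mem_range ha b
  obtain ⟨d, hd⟩ := hα.gate_mem_range hb c
  have h1 := leftMinimal_gate_gate R₁ hb
  have h2 := leftMinimal_gate R₂ (α c)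
  rw [← hc, ← hd, hα.2] at h1
  rw [← hd, hα.2] at h2
  exact ⟨c, d, hc ▸ gate_mem _ _, hd ▸ gate_mem _ _, h1, h2⟩

end IsApartMap

theorem gdist_eq_of_minimal_pairs {R₁ R₂ : X.Res} {C C' D D' : X.Chamber} (hC : C ∈ R₁.1)
    (hC' : C' ∈ R₁.1) (hD : D ∈ R₂.1) (hD' : D' ∈ R₂.1)
    (h1 : cs.LeftMinimal (Wt R₁) (X.delta C D)) (h2 : cs.LeftMinimal (Wt R₂) (X.delta D C))
    (h1' : cs.LeftMinimal (Wt R₁) (X.delta C' D'))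
    (h2' : cs.LeftMinimal (Wt R₂) (X.delta D' C')) : X.gdist C D = X.gdist C' D' := by
  have e1 := X.gdist_add_of_leftMinimal (delta_mem_Wt hC' hC) h1
  have e2 := X.gdist_add_of_leftMinimal (delta_mem_Wt hC hC') h1'
  have e3 := X.gdist_add_of_leftMinimal (delta_mem_Wt hD' hD) h2
  have e4 := X.gdist_add_of_leftMinimal (delta_mem_Wt hD hD') h2'
  rw [X.gdist_comm D C] at e3
  rw [X.gdist_comm D' C'] at e4
  rw [X.gdist_comm D' C, X.gdist_comm D' D] at e3
  rw [X.gdist_comm D C'] at e4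
  rw [X.gdist_comm C' C] at e1
  omega

theorem exists_isApartMap_res (R₁ R₂ : X.Res) : ∃ α : W → X.Chamber, X.IsApartMap α ∧
    (∃ c, α c ∈ R₁.1) ∧ ∃ d, α d ∈ R₂.1 := by
  obtain ⟨C, hC⟩ := res_nonempty R₁
  obtain ⟨D, hD⟩ := res_nonempty R₂
  obtain ⟨α, hα, h1, -, h2⟩ := X.exists_isApartMap (C := C) (D := D) (E := C)
    (by rw [(X.gdist_eq_zero_iff).2 rfl, zero_add])
  exact ⟨α, hα, ⟨_, h1 ▸ hC⟩, ⟨_, h2 ▸ hD⟩⟩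

/-- Twice the root-distance, computed in the apartment `A`. -/
def rootNum (A : Set X.Chamber) (R₁ R₂ : X.Res) : ℕ :=
  (X.PhiSep A R₁ R₂).ncard + (X.PhiSep A R₂ R₁).ncard

namespace IsApartMap

variable {α : W → X.Chamber}

theorem rootNum_eq (hα : X.IsApartMap α)
    {R₁ R₂ : X.Res} {c d : W} (hc : α c ∈ R₁.1) (hd : α d ∈ R₂.1)
    (h1 : cs.LeftMinimal (Wt R₁) (c⁻¹ * d)) (h2 : cs.LeftMinimal (Wt R₂) (d⁻¹ * c)) :
    rootNum (Set.range α) R₁ R₂ + 2 * reflNum (X.projRes R₁ R₂) =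
      2 * X.gdist (α c) (α d) + reflNum R₁ + reflNum R₂ := by
  have e1 := hα.ncard_phiSep hc hd h1 h2
  have e2 := hα.ncard_phiSep hd hc h2 h1
  have e3 := hα.ncard_cross_and hc hd h1
  have e4 : {t | Cross α t R₂ ∧ Cross α t R₁} = {t | Cross α t R₁ ∧ Cross α t R₂} := by
    ext t; exact and_comm
  have e5 : X.gdist (α c) (α d) = cs.length (c⁻¹ * d) := by rw [gdist, hα.2]
  have e6 : cs.length (d⁻¹ * c) = cs.length (c⁻¹ * d) := by
    rw [← length_inv, mul_inv_rev, inv_inv]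
  rw [e4] at e2
  rw [rootNum]
  omega

theorem rootDist_eq (hα : X.IsApartMap α)
    {R₁ R₂ : X.Res} {a b : W} (ha : α a ∈ R₁.1) (hb : α b ∈ R₂.1) :
    X.rootDist R₁ R₂ = (rootNum (Set.range α) R₁ R₂ : ℝ) / 2 := by
  have hex : ∃ A : Set X.Chamber, X.IsApartment A ∧ X.LiesIn R₁ A ∧ X.LiesIn R₂ A :=
    ⟨_, ⟨α, hα, rfl⟩, ⟨_, ha, a, rfl⟩, ⟨_, hb, b, rfl⟩⟩
  obtain ⟨⟨β, hβ, hr⟩, h1, h2⟩ := Classical.epsilon_spec hex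
  change X.chooseApt R₁ R₂ = Set.range β at hr
  change X.LiesIn R₁ (X.chooseApt R₁ R₂) at h1
  change X.LiesIn R₂ (X.chooseApt R₁ R₂) at h2
  rw [hr] at h1 h2
  obtain ⟨_, ha', a', rfl⟩ := h1
  obtain ⟨_, hb', b', rfl⟩ := h2
  obtain ⟨c, d, hc, hd, hcd, hdc⟩ := hα.exists_minimal_pair ha hb
  obtain ⟨c', d', hc', hd', hcd', hdc'⟩ := hβ.exists_minimal_pair ha' hb'
  have e1 := hα.rootNum_eq hc hd hcd hdc
  have e2 := hβ.rootNum_eq hc' hd' hcd' hdc'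
  rw [← hα.2] at hcd hdc
  rw [← hβ.2] at hcd' hdc'
  have e3 := gdist_eq_of_minimal_pairs hc hc' hd hd' hcd hdc hcd' hdc'
  have e4 : rootNum (Set.range β) R₁ R₂ = rootNum (Set.range α) R₁ R₂ := by omega
  rw [rootDist, hr]
  change ((rootNum (Set.range β) R₁ R₂ : ℕ) : ℝ) / 2 = _
  rw [e4]

end IsApartMap

/-- The formula for the root-distance in terms of a minimal pair of chambers. -/
theorem two_mul_rootDist {R₁ R₂ : X.Res} {C D : X.Chamber} (hC : C ∈ R₁.1) (hD : D ∈ R₂.1)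
    (h1 : cs.LeftMinimal (Wt R₁) (X.delta C D)) (h2 : cs.LeftMinimal (Wt R₂) (X.delta D C)) :
    2 * X.rootDist R₁ R₂ + 2 * reflNum (X.projRes R₁ R₂) =
      2 * X.gdist C D + reflNum R₁ + reflNum R₂ := by
  obtain ⟨α, hα, e1, -, e2⟩ := X.exists_isApartMap (C := C) (D := D) (E := C)
    (by rw [(X.gdist_eq_zero_iff).2 rfl, zero_add])
  rw [← e1] at hC
  rw [← e2] at hD
  have h3 := hα.rootNum_eq hC hD (by rw [← hα.2, e1, e2]; exact h1)
    (by rw [← hα.2, e1, e2]; exact h2)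
  rw [e1, e2] at h3
  rw [hα.rootDist_eq hC hD]
  have h4 : (rootNum (Set.range α) R₁ R₂ : ℝ) + 2 * reflNum (X.projRes R₁ R₂) =
      2 * X.gdist C D + reflNum R₁ + reflNum R₂ := by exact_mod_cast h3
  linarith

end Bldg

namespace Bldg

open CoxeterSystem

variable {cs : CoxeterSystem M W} {X : Bldg cs}

/-- The residue `R` meets the side of `α u` of the wall of the reflection `t`. -/
def Meets (α : W → X.Chamber) (u t : W) (R : X.Res) : Prop :=
  ∃ v, α v ∈ R.1 ∧ ¬ cs.Sep t u v

theorem sep_iff_not_sep_mul {t : W} (ht : cs.IsReflection t) (c v : W) :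
    cs.Sep t c v ↔ ¬ cs.Sep t (t * c) v :=
  sep_iff_not_sep (sep_self_mul ht c)

theorem meets_mul_iff (α : W → X.Chamber) {t : W} (ht : cs.IsReflection t) (u : W) (R : X.Res) :
    Meets α (t * u) t R ↔ ∃ v, α v ∈ R.1 ∧ cs.Sep t u v := by
  unfold Meets
  simp_rw [sep_iff_not_sep_mul ht u]

theorem meets_or_meets {α : W → X.Chamber} {t : W} (ht : cs.IsReflection t) (u : W) {R : X.Res}
    {c : W} (hc : α c ∈ R.1) : Meets α u t R ∨ Meets α (t * u) t R := by
  rw [meets_mul_iff α ht]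
  by_cases h : cs.Sep t u c
  · exact Or.inr ⟨c, hc, h⟩
  · exact Or.inl ⟨c, hc, h⟩

theorem cross_iff_meets {α : W → X.Chamber} {t : W} (ht : cs.IsReflection t) (u : W) {R : X.Res} :
    Cross α t R ↔ Meets α u t R ∧ Meets α (t * u) t R := by
  rw [meets_mul_iff α ht]
  constructor
  · rintro ⟨v, w, hv, hw, h⟩
    by_cases h1 : cs.Sep t u v
    · exact ⟨⟨w, hw, fun h2 => (sep_iff_not_sep h1).1 h2 h⟩, v, hv, h1⟩
    · exact ⟨⟨v, hv, h1⟩, w, hw, (not_sep_trans h1).2 h⟩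
  · rintro ⟨⟨v, hv, h1⟩, w, hw, h2⟩
    exact ⟨v, w, hv, hw, (not_sep_trans h1).1 h2⟩

theorem containedInRoot_side_iff_not_meets (α : W → X.Chamber) (hα : X.IsApartMap α) {t : W}
    (ht : cs.IsReflection t) (c : W) (R : X.Res) :
    X.ContainedInRoot R (Set.range α) (side α c t) ↔ ¬ Meets α (t * c) t R := by
  rw [meets_mul_iff α ht]
  constructor
  · rintro h ⟨v, hv, hs⟩
    exact hα.mem_side_iff.1 (h ⟨hv, v, rfl⟩) hs
  · rintro h _ ⟨hv, v, rfl⟩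
    exact hα.mem_side_iff.2 fun hs => h ⟨v, hv, hs⟩

/-- The set of roots of the apartment `A` that contain exactly one of `R₁` and `R₂`. -/
def rootDiff (A : Set X.Chamber) (R₁ R₂ : X.Res) : Set (Set X.Chamber) :=
  {φ | X.IsRootOf A φ ∧ ¬ (X.ContainedInRoot R₁ A φ ↔ X.ContainedInRoot R₂ A φ)}

theorem rootDiff_eq (A : Set X.Chamber) (R₁ R₂ : X.Res) :
    rootDiff A R₁ R₂ = X.PhiSep A R₁ R₂ ∪ X.PhiSep A R₂ R₁ := by
  ext φ
  simp only [rootDiff, PhiSep, Set.mem_ofPred_eq, Set.mem_union]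
  tauto

namespace IsApartMap

variable {α : W → X.Chamber}

theorem rootDiff_finite (hα : X.IsApartMap α)
    {R₁ R₂ : X.Res} {a b : W} (ha : α a ∈ R₁.1) (hb : α b ∈ R₂.1) :
    (rootDiff (Set.range α) R₁ R₂).Finite := by
  rw [rootDiff_eq]
  exact (hα.phiSep_finite ha hb).union (hα.phiSep_finite hb ha)

theorem rootDist_eq_ncard_rootDiff (hα : X.IsApartMap α) {R₁ R₂ : X.Res} {a b : W} (ha : α a ∈ R₁.1)
    (hb : α b ∈ R₂.1) : X.rootDist R₁ R₂ = ((rootDiff (Set.range α) R₁ R₂).ncard : ℝ) / 2 := by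
  rw [hα.rootDist_eq ha hb, rootDiff_eq, Set.ncard_union_eq _ (hα.phiSep_finite ha hb)
    (hα.phiSep_finite hb ha), rootNum]
  rw [Set.disjoint_left]
  exact fun φ h h' => h.2.2 h'.2.1

theorem rootDist_triangle (hα : X.IsApartMap α)
    {R₁ R₂ R₃ : X.Res} {a b c : W} (ha : α a ∈ R₁.1) (hb : α b ∈ R₂.1)
    (hc : α c ∈ R₃.1) : X.rootDist R₁ R₃ ≤ X.rootDist R₁ R₂ + X.rootDist R₂ R₃ := by
  rw [hα.rootDist_eq_ncard_rootDiff ha hb, hα.rootDist_eq_ncard_rootDiff hb hc,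
    hα.rootDist_eq_ncard_rootDiff ha hc]
  have h1 : (rootDiff (Set.range α) R₁ R₃) ⊆
      rootDiff (Set.range α) R₁ R₂ ∪ rootDiff (Set.range α) R₂ R₃ := by
    intro φ hφ
    simp only [rootDiff, Set.mem_ofPred_eq, Set.mem_union] at *
    tauto
  have h2 := (Set.ncard_le_ncard h1
    ((hα.rootDiff_finite ha hb).union (hα.rootDiff_finite hb hc))).trans (Set.ncard_union_le _ _)
  have h3 : ((rootDiff (Set.range α) R₁ R₃).ncard : ℝ) ≤
      (rootDiff (Set.range α) R₁ R₂).ncard + (rootDiff (Set.range α) R₂ R₃).ncard := by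
    exact_mod_cast h2
  linarith

theorem rootDist_add_iff (hα : X.IsApartMap α)
    {R₁ R₂ R₃ : X.Res} {a b c : W} (ha : α a ∈ R₁.1) (hb : α b ∈ R₂.1)
    (hc : α c ∈ R₃.1) : X.rootDist R₁ R₃ = X.rootDist R₁ R₂ + X.rootDist R₂ R₃ ↔
      ∀ t u, cs.IsReflection t → (Meets α u t R₁ ↔ Meets α u t R₂) ∨
        (Meets α u t R₂ ↔ Meets α u t R₃) := by
  have h1 : (rootDiff (Set.range α) R₁ R₃) =
      (rootDiff (Set.range α) R₁ R₂ ∪ rootDiff (Set.range α) R₂ R₃) \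
      (rootDiff (Set.range α) R₁ R₂ ∩ rootDiff (Set.range α) R₂ R₃) := by
    ext φ
    simp only [rootDiff, Set.mem_ofPred_eq, Set.mem_union, Set.mem_inter_iff, Set.mem_sdiff]
    tauto
  have f1 := hα.rootDiff_finite ha hb
  have f2 := hα.rootDiff_finite hb hc
  have h2 := Set.ncard_union_add_ncard_inter _ _ f1 f2
  have h3 := Set.ncard_sdiff_add_ncard_of_subset
    (Set.inter_subset_left.trans Set.subset_union_left :
      rootDiff (Set.range α) R₁ R₂ ∩ rootDiff (Set.range α) R₂ R₃ ⊆
      rootDiff (Set.range α) R₁ R₂ ∪ rootDiff (Set.range α) R₂ R₃) (f1.union f2)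
  rw [← h1] at h3
  have h4 : (rootDiff (Set.range α) R₁ R₂ ∩ rootDiff (Set.range α) R₂ R₃).ncard = 0 ↔
      ∀ t u, cs.IsReflection t → (Meets α u t R₁ ↔ Meets α u t R₂) ∨
        (Meets α u t R₂ ↔ Meets α u t R₃) := by
    rw [Set.ncard_eq_zero (f1.subset Set.inter_subset_left), Set.eq_empty_iff_forall_notMem]
    constructor
    · intro h t u ht
      have h5 := h (side α (t * u) t)
      have h6 := hα.isRootOf_side ht (t * u)
      simp only [rootDiff, Set.mem_ofPred_eq, Set.mem_inter_iff, h6,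
        containedInRoot_side_iff_not_meets α hα ht, ← mul_assoc, ht.mul_self, one_mul] at h5
      tauto
    · rintro h φ ⟨h5, h6⟩
      obtain ⟨t, u, ht, rfl⟩ := hα.exists_eq_side h5.1
      have := h t (t * u) ht
      simp only [rootDiff, Set.mem_ofPred_eq,
        containedInRoot_side_iff_not_meets α hα ht] at h5 h6
      tauto
  rw [← h4, hα.rootDist_eq_ncard_rootDiff ha hb, hα.rootDist_eq_ncard_rootDiff hb hc,
    hα.rootDist_eq_ncard_rootDiff ha hc]
  have h5 : ((rootDiff (Set.range α) R₁ R₂).ncard : ℝ) + (rootDiff (Set.range α) R₂ R₃).ncard =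
      (rootDiff (Set.range α) R₁ R₃).ncard +
      2 * (rootDiff (Set.range α) R₁ R₂ ∩ rootDiff (Set.range α) R₂ R₃).ncard := by
    have : (rootDiff (Set.range α) R₁ R₂).ncard + (rootDiff (Set.range α) R₂ R₃).ncard =
      (rootDiff (Set.range α) R₁ R₃).ncard +
      2 * (rootDiff (Set.range α) R₁ R₂ ∩ rootDiff (Set.range α) R₂ R₃).ncard := by omega
    exact_mod_cast this
  rw [← Nat.cast_eq_zero (R := ℝ)]
  constructor <;> intro h <;> linarith

/-- A chamber of the apartment lying in the projection of `T` to `R` is the gate of a chamber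
of `T` lying in the apartment. -/
theorem exists_leftMinimal_of_mem_projRes (hα : X.IsApartMap α)
    {R T : X.Res} {a b v : W} (ha : α a ∈ R.1)
    (hb : α b ∈ T.1) (hv : α v ∈ (X.projRes R T).1) :
    ∃ w, α w ∈ T.1 ∧ cs.LeftMinimal (Wt R) (v⁻¹ * w) := by
  obtain ⟨c, d, hc, hd, hcd, -⟩ := hα.exists_minimal_pair ha hb
  have hcd' := hcd
  rw [← hα.2] at hcd'
  have hP := mem_projRes hc hd hcd'
  have h1 := (mem_Wt_projRes_iff hc hd hcd' _).1 ((hα.mem_iff hP v).1 hv)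
  refine ⟨v * (c⁻¹ * d), ?_, by simpa using hcd⟩
  rw [hα.mem_iff hd]
  have h2 := h1.2
  rw [hα.2] at h2
  simpa [mul_assoc] using h2

theorem exists_mem_projRes (hα : X.IsApartMap α)
    {R T : X.Res} {a w : W} (ha : α a ∈ R.1) (hw : α w ∈ T.1) :
    ∃ v, α v ∈ (X.projRes R T).1 ∧ cs.LeftMinimal (Wt R) (v⁻¹ * w) := by
  obtain ⟨v, hv⟩ := hα.gate_mem_range ha w
  have h := leftMinimal_gate R (α w)
  rw [← hv, hα.2] at h
  exact ⟨v, hv ▸ gate_mem_projRes R hw, h⟩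

theorem meets_projRes_iff (hα : X.IsApartMap α)
    {R T : X.Res} {a b t : W} (ha : α a ∈ R.1) (hb : α b ∈ T.1)
    (ht : cs.IsReflection t) (u : W) : Meets α u t (X.projRes R T) ↔
      Meets α u t R ∧ (Meets α (t * u) t R → Meets α u t T) := by
  constructor
  · rintro ⟨v, hv, hs⟩
    have hvR := projRes_subset R T hv
    refine ⟨⟨v, hvR, hs⟩, fun h => ?_⟩
    have hx := (cross_iff_meets ht u).2 ⟨⟨v, hvR, hs⟩, h⟩
    obtain ⟨w, hw, hm⟩ := hα.exists_leftMinimal_of_mem_projRes ha hb hv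
    have h1 := hm.not_sep ((hα.cross_iff hvR).1 hx).2
    exact ⟨w, hw, fun h2 => h1 ((not_sep_trans hs).1 h2)⟩
  · rintro ⟨h1, h2⟩
    by_cases h3 : Meets α (t * u) t R
    · obtain ⟨w, hw, hs⟩ := h2 h3
      obtain ⟨v, hv, hm⟩ := hα.exists_mem_projRes ha hw
      have hx := (cross_iff_meets ht u).2 ⟨h1, h3⟩
      have h4 := hm.not_sep ((hα.cross_iff (projRes_subset R T hv)).1 hx).2
      exact ⟨v, hv, fun h5 => hs ((not_sep_trans h4).1 h5.symm).symm⟩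
    · obtain ⟨v, hv, -⟩ := hα.exists_mem_projRes ha hb
      refine ⟨v, hv, fun h4 => h3 ?_⟩
      rw [meets_mul_iff α ht]
      exact ⟨v, projRes_subset R T hv, h4⟩

theorem cross_projRes_iff (hα : X.IsApartMap α)
    {R T : X.Res} {a b t : W} (ha : α a ∈ R.1) (hb : α b ∈ T.1) :
    Cross α t (X.projRes R T) ↔ Cross α t R ∧ Cross α t T := by
  by_cases ht : cs.IsReflection t
  · have h1 := hα.meets_projRes_iff ha hb ht 1
    have h2 := hα.meets_projRes_iff ha hb ht (t * 1)
    rw [← mul_assoc, ht.mul_self, one_mul] at h2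
    rw [cross_iff_meets ht 1, cross_iff_meets ht 1, cross_iff_meets ht 1]
    tauto
  · have (R : X.Res) : ¬ Cross α t R := fun h => ht h.isReflection
    simp [this]

end IsApartMap

end Bldg

namespace Bldg

open CoxeterSystem

variable {cs : CoxeterSystem M W} {X : Bldg cs}

theorem leftMinimal_of_not_sep {H : Subgroup W} {u v : W}
    (h : ∀ t, u⁻¹ * t * u ∈ H → ¬ cs.Sep t u v) : cs.LeftMinimal H (u⁻¹ * v) := by
  intro t ht hi
  have h1 : u⁻¹ * (u * t * u⁻¹) * u = t := by simp [mul_assoc]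
  refine h (u * t * u⁻¹) (by rwa [h1]) ?_
  rw [sep_iff (hi.1.conj u), h1]
  exact hi

theorem rootDist_comm (R T : X.Res) : X.rootDist R T = X.rootDist T R := by
  obtain ⟨α, hα, ⟨c, hc⟩, d, hd⟩ := exists_isApartMap_res R T
  rw [hα.rootDist_eq hc hd, hα.rootDist_eq hd hc, rootNum, rootNum, add_comm]

theorem Meets.mono {α : W → X.Chamber} {u t : W} {R T : X.Res} (h : Meets α u t R)
    (hRT : R.1 ⊆ T.1) : Meets α u t T := by
  obtain ⟨v, hv, hs⟩ := h
  exact ⟨v, hRT hv, hs⟩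

theorem Cross.mono {α : W → X.Chamber} {t : W} {R T : X.Res} (h : Cross α t R)
    (hRT : R.1 ⊆ T.1) : Cross α t T := by
  obtain ⟨v, w, hv, hw, hs⟩ := h
  exact ⟨v, w, hRT hv, hRT hw, hs⟩

/-- The residues that lie in the apartment given by `α` and meet every half-apartment which
both `R₁` and `R₂` meet. -/
def apartHull (α : W → X.Chamber) (R₁ R₂ : X.Res) : Set X.Res :=
  {σ | (∃ c, α c ∈ σ.1) ∧
    ∀ t u, cs.IsReflection t → Meets α u t R₁ → Meets α u t R₂ → Meets α u t σ}

theorem IsApartMap.convexResSet_apartHull {α : W → X.Chamber} (hα : X.IsApartMap α)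
    (R₁ R₂ : X.Res) : X.ConvexResSet (apartHull α R₁ R₂) := by
  constructor
  · rintro σ τ hle ⟨⟨c, hc⟩, h⟩
    exact ⟨⟨c, hle hc⟩, fun t u ht h1 h2 => (h t u ht h1 h2).mono hle⟩
  · rintro σ ⟨⟨c, hc⟩, h⟩ τ ⟨⟨d, hd⟩, h'⟩
    refine ⟨?_, fun t u ht h1 h2 => ?_⟩
    · obtain ⟨v, hv, -⟩ := hα.exists_mem_projRes hc hd
      exact ⟨v, hv⟩
    · rw [hα.meets_projRes_iff hc hd ht]
      exact ⟨h t u ht h1 h2, fun _ => h' t u ht h1 h2⟩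

theorem IsApartMap.projRes_mem_interval {α : W → X.Chamber} (hα : X.IsApartMap α)
    {R₁ R₂ σ : X.Res} {a b : W} (ha : α a ∈ R₁.1) (hb : α b ∈ R₂.1)
    (hσ : σ ∈ apartHull α R₁ R₂) : X.projRes σ R₁ ∈ X.interval R₁ R₂ := by
  obtain ⟨⟨c, hc⟩, h⟩ := hσ
  obtain ⟨v, hv, -⟩ := hα.exists_mem_projRes hc ha
  refine (hα.rootDist_add_iff ha hv hb).2 fun t u ht => ?_
  have h1 := h t u ht
  have h2 := h t (t * u) ht
  have h3 := meets_or_meets ht u ha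
  have h4 := meets_or_meets ht u hb
  rw [hα.meets_projRes_iff hc ha ht]
  tauto

theorem conv2_subset_resClosure_interval (R₁ R₂ : X.Res) :
    X.conv2 R₁ R₂ ⊆ X.resClosure (X.interval R₁ R₂) := by
  obtain ⟨α, hα, ⟨a, ha⟩, b, hb⟩ := exists_isApartMap_res R₁ R₂
  intro σ hσ 𝓢 h𝓢
  have h1 : σ ∈ apartHull α R₁ R₂ := by
    refine hσ _ ⟨hα.convexResSet_apartHull R₁ R₂, ?_⟩
    rintro T (rfl | rfl)
    · exact ⟨⟨a, ha⟩, fun t u _ h _ => h⟩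
    · exact ⟨⟨b, hb⟩, fun t u _ _ h => h⟩
  exact h𝓢.1 σ _ (projRes_subset σ R₁) (h𝓢.2 (hα.projRes_mem_interval ha hb h1))

theorem rootDist_projRes_le (σ R₁ R₂ : X.Res) :
    X.rootDist R₁ (X.projRes σ R₁) + X.rootDist (X.projRes σ R₁) R₂ ≤
      X.rootDist R₁ σ + X.rootDist σ R₂ := by
  obtain ⟨α, hα, ⟨a, ha⟩, c, hc⟩ := exists_isApartMap_res R₁ σ
  obtain ⟨v, hv, -⟩ := hα.exists_mem_projRes hc ha
  have h1 : X.rootDist R₁ σ =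
      X.rootDist R₁ (X.projRes σ R₁) + X.rootDist (X.projRes σ R₁) σ := by
    refine (hα.rootDist_add_iff ha hv hc).2 fun t u ht => ?_
    have h3 := meets_or_meets ht u ha
    have h4 := meets_or_meets ht u hc
    rw [hα.meets_projRes_iff hc ha ht]
    tauto
  obtain ⟨β, hβ, ⟨d, hd⟩, b, hb⟩ := exists_isApartMap_res (X.projRes σ R₁) R₂
  have h2 := hβ.rootDist_triangle hd (projRes_subset σ R₁ hd) hb
  linarith

/-- In every apartment in which `τ` and `R` lie, the walls crossing `τ` also cross `R`. -/
def ParallelInto (τ R : X.Res) : Prop :=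
  ∀ α : W → X.Chamber, X.IsApartMap α → (∃ c, α c ∈ τ.1) → (∃ d, α d ∈ R.1) →
    ∀ t, Cross α t τ → Cross α t R

theorem parallelInto_projRes (σ R : X.Res) : ParallelInto (X.projRes σ R) R := by
  rintro α hα ⟨c, hc⟩ ⟨d, hd⟩ t h
  exact ((hα.cross_projRes_iff (projRes_subset σ R hc) hd).1 h).2

theorem ParallelInto.mono {σ τ R : X.Res} (h : ParallelInto τ R) (hσ : σ.1 ⊆ τ.1) :
    ParallelInto σ R := by
  rintro α hα ⟨c, hc⟩ ⟨d, hd⟩ t ht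
  exact h α hα ⟨c, hσ hc⟩ ⟨d, hd⟩ t (ht.mono hσ)

theorem exists_parallelInto (σ R₁ R₂ : X.Res) : ∃ τ : X.Res, τ.1 ⊆ σ.1 ∧ ParallelInto τ R₁ ∧
    ParallelInto τ R₂ ∧ X.rootDist R₁ τ + X.rootDist τ R₂ ≤
      X.rootDist R₁ σ + X.rootDist σ R₂ := by
  have h1 := projRes_subset (X.projRes σ R₁) R₂
  refine ⟨X.projRes (X.projRes σ R₁) R₂, h1.trans (projRes_subset σ R₁),
    (parallelInto_projRes σ R₁).mono h1, parallelInto_projRes _ R₂, ?_⟩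
  have h2 := rootDist_projRes_le σ R₁ R₂
  have h3 := rootDist_projRes_le (X.projRes σ R₁) R₂ R₁
  rw [rootDist_comm R₂, rootDist_comm _ R₁, rootDist_comm R₂, rootDist_comm _ R₁] at h3
  linarith

theorem reflNum_projRes_comm (R T : X.Res) :
    reflNum (X.projRes R T) = reflNum (X.projRes T R) := by
  obtain ⟨α, hα, ⟨a, ha⟩, b, hb⟩ := exists_isApartMap_res R T
  obtain ⟨c, d, hc, hd, hcd, hdc⟩ := hα.exists_minimal_pair ha hb
  rw [← hα.ncard_cross_and hc hd hcd, ← hα.ncard_cross_and hd hc hdc]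
  congr 1
  ext t
  exact and_comm

theorem gdist_le_reflNum {R : X.Res} {C D : X.Chamber} (hC : C ∈ R.1) (hD : D ∈ R.1) :
    X.gdist C D ≤ reflNum R := by
  rw [gdist, ← cs.ncard_leftInversions]
  exact Set.ncard_le_ncard
    (fun t ht => ⟨ht.1, IsLeftInversion.mem_parabolic ht (delta_mem_Wt hC hD)⟩)
    ((Wt_finite R).subset fun t ht => ht.2)

theorem exists_gdist_eq_reflNum {R : X.Res} {C : X.Chamber} (hC : C ∈ R.1) :
    ∃ D ∈ R.1, X.gdist C D = reflNum R := by
  obtain ⟨z, hz, h⟩ := cs.exists_longest (sphType_typ R)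
  obtain ⟨D, rfl⟩ := X.exists_delta_eq C z
  refine ⟨D, (mem_res_iff hC D).2 hz, le_antisymm (gdist_le_reflNum hC
    ((mem_res_iff hC D).2 hz)) ?_⟩
  rw [gdist, ← cs.ncard_leftInversions]
  exact Set.ncard_le_ncard (fun t ht => h t ht.2 ht.1) (cs.leftInversions_finite _)

theorem ParallelInto.leftMinimal_gate {τ R : X.Res} (h : ParallelInto τ R) {E : X.Chamber}
    (hE : E ∈ τ.1) : cs.LeftMinimal (Wt τ) (X.delta E (X.gate R.1 E)) := by
  obtain ⟨α, hα, h1, -, h2⟩ := X.exists_isApartMap (C := X.gate R.1 E) (D := E)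
    (E := X.gate R.1 E) (by rw [(X.gdist_eq_zero_iff).2 rfl, zero_add])
  set e := X.delta (X.gate R.1 E) E
  have hm := Bldg.leftMinimal_gate R E
  have hg := gate_mem R E
  rw [← h1] at hg
  rw [← h2] at hE
  have hm' : cs.LeftMinimal (Wt R) (1⁻¹ * e) := by simpa using hm
  have h3 := hα.2 e 1
  rw [h1, h2] at h3
  rw [h3]
  refine leftMinimal_of_not_sep fun t ht hs => ?_
  have h4 := h α hα ⟨_, hE⟩ ⟨_, hg⟩ t ((hα.cross_iff hE).2 ⟨hs.1, ht⟩)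
  exact hm'.not_sep ((hα.cross_iff hg).1 h4).2 hs.symm

theorem ParallelInto.reflNum_projRes {τ R : X.Res} (h : ParallelInto τ R) :
    reflNum (X.projRes R τ) = reflNum τ := by
  obtain ⟨α, hα, ⟨a, ha⟩, b, hb⟩ := exists_isApartMap_res R τ
  obtain ⟨c, d, hc, hd, hcd, hdc⟩ := hα.exists_minimal_pair ha hb
  rw [← hα.ncard_cross_and hc hd hcd, ← hα.ncard_cross hd]
  congr 1
  ext t
  exact ⟨fun h => h.2, fun ht => ⟨h α hα ⟨d, hd⟩ ⟨c, hc⟩ t ht, ht⟩⟩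

theorem ParallelInto.two_mul_rootDist {τ R : X.Res} (h : ParallelInto τ R) {E : X.Chamber}
    (hE : E ∈ τ.1) : 2 * X.rootDist R τ + reflNum τ =
      2 * X.gdist (X.gate R.1 E) E + reflNum R := by
  have h1 := Bldg.two_mul_rootDist (gate_mem R E) hE (Bldg.leftMinimal_gate R E)
    (h.leftMinimal_gate hE)
  rw [h.reflNum_projRes] at h1
  linarith

/-- A residue parallel into both ends of a pair, and on which the triangle inequality is an
equality, lies in a common apartment with the pair. -/
theorem exists_isApartMap_of_rootDist_le {τ R₁ R₂ : X.Res} (h1 : ParallelInto τ R₁)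
    (h2 : ParallelInto τ R₂)
    (hd : X.rootDist R₁ τ + X.rootDist τ R₂ ≤ X.rootDist R₁ R₂) :
    ∃ α : W → X.Chamber, X.IsApartMap α ∧ (∃ a, α a ∈ R₁.1) ∧ (∃ e, α e ∈ τ.1) ∧
      ∃ b, α b ∈ R₂.1 := by
  suffices H : ∃ E ∈ τ.1, X.gdist (X.gate R₁.1 E) (X.gate R₂.1 E) =
      X.gdist (X.gate R₁.1 E) E + X.gdist E (X.gate R₂.1 E) by
    obtain ⟨E, hE, h⟩ := H
    obtain ⟨α, hα, e1, e2, e3⟩ := X.exists_isApartMap h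
    exact ⟨α, hα, ⟨_, e1 ▸ gate_mem _ _⟩, ⟨_, e2 ▸ hE⟩, _, e3 ▸ gate_mem _ _⟩
  by_contra! H
  obtain ⟨E, hE⟩ := res_nonempty τ
  obtain ⟨E', hE', hn⟩ := exists_gdist_eq_reflNum hE
  have key : ∀ F ∈ τ.1, ∃ m, X.gdist (X.gate R₁.1 F) (X.gate R₂.1 F) =
      X.gdist (X.gate R₁.1 F) (X.gate R₁.1 (X.gate R₂.1 F)) + m +
      X.gdist (X.gate R₂.1 (X.gate R₁.1 (X.gate R₂.1 F))) (X.gate R₂.1 F) ∧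
      2 * X.rootDist R₁ R₂ + 2 * reflNum (X.projRes R₁ R₂) = 2 * m + reflNum R₁ + reflNum R₂ := by
    intro F hF
    refine ⟨_, ?_, Bldg.two_mul_rootDist (gate_mem R₁ (X.gate R₂.1 F))
      (gate_mem R₂ (X.gate R₁.1 (X.gate R₂.1 F))) (leftMinimal_gate_gate R₁ (gate_mem R₂ F))
      (leftMinimal_gate R₂ _)⟩
    have e1 := gdist_gate (gate_mem R₁ F) (X.gate R₂.1 F)
    have e2 := gdist_gate (gate_mem R₂ F) (X.gate R₁.1 (X.gate R₂.1 F))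
    rw [X.gdist_comm, X.gdist_comm (X.gate R₂.1 F)] at e2
    rw [e1, e2, X.gdist_comm (X.gate R₂.1 (X.gate R₁.1 (X.gate R₂.1 F)))
      (X.gate R₁.1 (X.gate R₂.1 F))]
    omega
  have stretch : ∀ {R : X.Res}, ParallelInto τ R →
      X.gdist (X.gate R.1 E) E = X.gdist (X.gate R.1 E') E' ∧
      reflNum τ ≤ X.gdist (X.gate R.1 E) (X.gate R.1 E') := by
    intro R h
    have e1 := h.two_mul_rootDist hE
    have e2 := h.two_mul_rootDist hE'
    have e3 : (X.gdist (X.gate R.1 E) E : ℝ) = X.gdist (X.gate R.1 E') E' := by linarith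
    have e4 : X.gdist (X.gate R.1 E) E = X.gdist (X.gate R.1 E') E' := by exact_mod_cast e3
    refine ⟨e4, ?_⟩
    have e5 := X.gdist_add_of_leftMinimal (delta_mem_Wt hE' hE) (h.leftMinimal_gate hE)
    have e6 := X.gdist_triangle (X.gate R.1 E) (X.gate R.1 E') E'
    rw [X.gdist_comm E' (X.gate R.1 E), X.gdist_comm E' E, X.gdist_comm E (X.gate R.1 E)] at e5
    omega
  have hproj : ∀ {R T : X.Res} (C D : X.Chamber), C ∈ T.1 → D ∈ T.1 →
      X.gdist (X.gate R.1 C) (X.gate R.1 D) ≤ reflNum (X.projRes R T) := fun C D hC hD =>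
    gdist_le_reflNum (gate_mem_projRes _ hC) (gate_mem_projRes _ hD)
  obtain ⟨m, k1, k2⟩ := key E hE
  obtain ⟨m', k1', k2'⟩ := key E' hE'
  have hm : m = m' := by
    have : (m : ℝ) = m' := by linarith
    exact_mod_cast this
  obtain ⟨s1, s2⟩ := stretch h1
  obtain ⟨s3, s4⟩ := stretch h2
  have d1 := h1.two_mul_rootDist hE
  have d2 := h2.two_mul_rootDist hE
  rw [rootDist_comm] at d2
  have hle : X.gdist (X.gate R₁.1 E) E + X.gdist (X.gate R₂.1 E) E + reflNum (X.projRes R₁ R₂) ≤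
      m + reflNum τ := by
    have : (X.gdist (X.gate R₁.1 E) E + X.gdist (X.gate R₂.1 E) E +
      reflNum (X.projRes R₁ R₂) : ℝ) ≤ m + reflNum τ := by linarith
    exact_mod_cast this
  have n1 := H E hE
  have n2 := H E' hE'
  have t1 := X.gdist_triangle (X.gate R₁.1 E) E (X.gate R₂.1 E)
  have t2 := X.gdist_triangle (X.gate R₁.1 E') E' (X.gate R₂.1 E')
  rw [X.gdist_comm E] at n1 t1
  rw [X.gdist_comm E'] at n2 t2
  set C := X.gate R₁.1 E
  set D := X.gate R₂.1 E
  set C' := X.gate R₁.1 E'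
  set D' := X.gate R₂.1 E'
  set C₁ := X.gate R₁.1 D
  set C₁' := X.gate R₁.1 D'
  set D₁ := X.gate R₂.1 C₁
  set D₁' := X.gate R₂.1 C₁'
  have p1 : X.gdist C₁ C₁' ≤ reflNum (X.projRes R₁ R₂) := hproj D D' (gate_mem _ _) (gate_mem _ _)
  have p2 : X.gdist D₁ D₁' ≤ reflNum (X.projRes R₂ R₁) :=
    hproj C₁ C₁' (gate_mem _ _) (gate_mem _ _)
  rw [reflNum_projRes_comm] at p2
  have q1 := X.gdist_triangle C C₁ C'
  have q2 := X.gdist_triangle C₁ C₁' C'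
  have q3 := X.gdist_triangle D D₁ D'
  have q4 := X.gdist_triangle D₁ D₁' D'
  rw [X.gdist_comm C₁' C'] at q2
  rw [X.gdist_comm D D₁] at q3
  omega

end Bldg

namespace Bldg

open CoxeterSystem

variable {cs : CoxeterSystem M W} {X : Bldg cs}

namespace IsApartMap

variable {α : W → X.Chamber}

theorem Wt_le_of_cross (hα : X.IsApartMap α) {P T : X.Res} {c : W} (hP : α c ∈ P.1) (hT : α c ∈ T.1)
    (h : ∀ t, Cross α t P → Cross α t T) : Wt P ≤ Wt T := by
  refine (Subgroup.closure_le _).2 ?_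
  rintro _ ⟨i, hi, rfl⟩
  have h1 := h (c * cs.simple i * c⁻¹) ((hα.cross_iff hP).2
    ⟨(cs.isReflection_simple i).conj c, by simpa [mul_assoc] using simple_mem_parabolic cs hi⟩)
  simpa [mul_assoc] using ((hα.cross_iff hT).1 h1).2

theorem eq_of_cross_iff (hα : X.IsApartMap α)
    {P T : X.Res} {c : W} (hP : α c ∈ P.1) (hT : α c ∈ T.1)
    (h : ∀ t, Cross α t P ↔ Cross α t T) : P = T :=
  res_eq_of_Wt_eq hP hT (le_antisymm (hα.Wt_le_of_cross hP hT fun t => (h t).1)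
    (hα.Wt_le_of_cross hT hP fun t => (h t).2))

/-- If `P` and `τ` are crossed by the same walls and `s` is a left descent of `c⁻¹ * e`, then
then `τ` has a chamber `α e'` such that all of `insert s (typ P)` are left descents of `c⁻¹ * e'`. -/
theorem exists_forall_isLeftDescent (hα : X.IsApartMap α)
    {P τ : X.Res} {c e : W} {i : B} (hc : α c ∈ P.1)
    (he : α e ∈ τ.1) (hPτ : ∀ t, Cross α t P ↔ Cross α t τ)
    (hmin : cs.LeftMinimal (Wt P) (c⁻¹ * e)) (hi : cs.IsLeftDescent (c⁻¹ * e) i) :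
    ∃ e', α e' ∈ τ.1 ∧ ∀ k ∈ insert i (typ P), cs.IsLeftDescent (c⁻¹ * e') k := by
  obtain ⟨z, hz, hzl⟩ := cs.exists_longest (sphType_typ P)
  have hτ : α (c * z * c⁻¹ * e) ∈ τ.1 := by
    rw [hα.mem_iff he]
    have hle : Wt P ≤ (Wt τ).comap (MulAut.conj (e⁻¹ * c)).toMonoidHom := by
      refine (Subgroup.closure_le _).2 ?_
      rintro _ ⟨j, hj, rfl⟩
      have h1 := (hPτ (c * cs.simple j * c⁻¹)).1 ((hα.cross_iff hc).2
        ⟨(cs.isReflection_simple j).conj c,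
          by simpa [mul_assoc] using simple_mem_parabolic cs hj⟩)
      simpa [mul_assoc] using ((hα.cross_iff he).1 h1).2
    simpa [mul_assoc] using hle hz
  refine ⟨c * z * c⁻¹ * e, hτ, ?_⟩
  rintro k (rfl | hk)
  · have hs : cs.Sep (c * cs.simple k * c⁻¹) c e :=
      (sep_conj_iff (cs.isReflection_simple k) c e).2 ⟨cs.isReflection_simple k, hi⟩
    have h1 : cs.Sep (c * cs.simple k * c⁻¹) c (c * z * c⁻¹ * e) := by
      by_contra h2
      refine hα.not_cross_of_sep hc hmin hs ((hPτ _).2 ?_)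
      exact ⟨_, _, hτ, he, (not_sep_trans h2).1 hs⟩
    exact ((sep_conj_iff (cs.isReflection_simple k) c _).1 h1).2
  · have hprod : c⁻¹ * (c * z * c⁻¹ * e) = z * (c⁻¹ * e) := by simp [mul_assoc]
    have hk' := simple_mem_parabolic cs hk
    have h1 := hzl _ hk' (cs.isReflection_simple k)
    have h2 := hmin (z⁻¹ * cs.simple k * z) (mul_mem (mul_mem (inv_mem hz) hk') hz)
    have h3 := (isLeftInversion_mul_iff cs (cs.isReflection_simple k) z (c⁻¹ * e)).2 (by tauto)
    rw [hprod]
    exact h3.2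

theorem mem_of_between (hα : X.IsApartMap α)
    {𝓡 : Set X.Res} (h𝓡 : X.ConvexResSet 𝓡) {τ Q : X.Res} (hQ : Q ∈ 𝓡)
    {d e : W} (he : α e ∈ τ.1) (hd : α d ∈ Q.1) (hQτ : ∀ t, Cross α t Q ↔ Cross α t τ)
    (hdmin : cs.LeftMinimal (Wt Q) (d⁻¹ * e)) {P : X.Res} {c : W} (hP : P ∈ 𝓡)
    (hc : α c ∈ P.1) (hPτ : ∀ t, Cross α t P ↔ Cross α t τ)
    (hcmin : cs.LeftMinimal (Wt P) (c⁻¹ * e)) (hsep : ∀ t, cs.Sep t c e → ¬ cs.Sep t e d) :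
    τ ∈ 𝓡 := by
  induction hn : cs.length (c⁻¹ * e) using Nat.strong_induction_on generalizing c P with
  | _ n ih =>
    subst hn
    by_cases hce : c⁻¹ * e = 1
    · obtain rfl : c = e := inv_mul_eq_one.1 hce
      rwa [← hα.eq_of_cross_iff hc he hPτ]
    obtain ⟨i, hi⟩ := cs.exists_leftDescent_of_ne_one hce
    obtain ⟨e', he', hK⟩ := hα.exists_forall_isLeftDescent hc he hPτ hcmin hi
    have hsph := sphType_of_forall_isLeftDescent hK
    set ρ : X.Res := mkRes hsph (α c) with hρ
    have hcρ : α c ∈ ρ.1 := mem_mkRes hsph _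
    have hW : Wt ρ = cs.parabolic (insert i (typ P)) := Wt_mkRes hsph _
    have hPρ : P.1 ⊆ ρ.1 := by
      refine subset_of_Wt_le hc hcρ ?_
      rw [hW]
      exact Subgroup.closure_mono (Set.image_mono (Set.subset_insert _ _))
    have hρ𝓡 : ρ ∈ 𝓡 := h𝓡.1 ρ P hPρ hP
    have hcross : ∀ t, Cross α t ρ → ¬ Cross α t τ → cs.Sep t c e := by
      intro t h1 h2
      have h3 := ((hα.cross_iff hcρ).1 h1).2
      rw [hW] at h3
      have h4 : cs.Sep t c e' := (sep_iff h1.isReflection c e').2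
        (isLeftInversion_of_forall_isLeftDescent hK h3 (isReflection_conj_inv h1.isReflection c))
      by_contra h5
      exact h2 ⟨e, e', he, he', (not_sep_trans h5).1 h4⟩
    obtain ⟨c₁, hc₁⟩ := hα.gate_mem_range hcρ e
    have hc₁ρ : α c₁ ∈ ρ.1 := hc₁ ▸ gate_mem _ _
    have hm1 : cs.LeftMinimal (Wt ρ) (c₁⁻¹ * e) := by
      rw [← hα.2, hc₁]; exact leftMinimal_gate _ _
    have hm2 : cs.LeftMinimal (Wt ρ) (c₁⁻¹ * d) := by
      refine leftMinimal_of_not_sep fun t ht hs => ?_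
      have h1 := (not_sep_trans (hm1.not_sep ht)).1 hs
      have h2 : Cross α t ρ := (hα.cross_iff hc₁ρ).2 ⟨hs.1, ht⟩
      by_cases h3 : Cross α t τ
      · exact hdmin.not_sep ((hα.cross_iff hd).1 ((hQτ t).2 h3)).2 h1.symm
      · exact hsep t (hcross t h2 h3) h1
    have hlen : cs.length (c⁻¹ * e) = cs.length (c⁻¹ * c₁) + cs.length (c₁⁻¹ * e) := by
      have := gdist_gate hcρ (α e)
      rw [← hc₁] at this
      simpa only [gdist, hα.2] using this
    have hne : cs.length (c⁻¹ * c₁) ≠ 0 := by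
      rw [Ne, length_eq_zero_iff]
      intro h
      obtain rfl : c = c₁ := inv_mul_eq_one.1 h
      refine hm1 (cs.simple i) ?_ ⟨cs.isReflection_simple i, hi⟩
      rw [hW]
      exact simple_mem_parabolic cs (Set.mem_insert _ _)
    have hP' : α c₁ ∈ (X.projRes ρ Q).1 := mem_projRes hc₁ρ hd (by rwa [hα.2])
    refine ih _ (by omega) (h𝓡.2 ρ hρ𝓡 Q hQ) hP' (fun t => ?_)
      (hm1.mono (Wt_le_of_subset (projRes_subset ρ Q))) (fun t ht => ?_) rfl
    · rw [hα.cross_projRes_iff hcρ hd, hQτ, ← hPτ]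
      exact ⟨fun h => h.2, fun h => ⟨h.mono hPρ, h⟩⟩
    · refine hsep t ?_
      have h1 := (cs.length_eq_add_iff_sep c c₁ e).1 hlen t
      have h2 : ¬ cs.Sep t c₁ c := fun h => h1 h.symm ht
      exact (not_sep_trans h2).1 ht

end IsApartMap

theorem ConvexResSet.mem_of_mem_interval {R₁ R₂ σ : X.Res} {𝓡 : Set X.Res} (h𝓡 : X.ConvexResSet 𝓡)
    (h1 : R₁ ∈ 𝓡) (h2 : R₂ ∈ 𝓡) (hσ : σ ∈ X.interval R₁ R₂) : σ ∈ 𝓡 := by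
  obtain ⟨τ, hτσ, p1, p2, hle⟩ := exists_parallelInto σ R₁ R₂
  refine h𝓡.1 σ τ hτσ ?_
  have hσ' : X.rootDist R₁ R₂ = X.rootDist R₁ σ + X.rootDist σ R₂ := hσ
  rw [← hσ'] at hle
  obtain ⟨α, hα, ⟨a, ha⟩, ⟨e, he⟩, b, hb⟩ := exists_isApartMap_of_rootDist_le p1 p2 hle
  have hbet := (hα.rootDist_add_iff ha he hb).1
    (le_antisymm (hα.rootDist_triangle ha he hb) hle)
  have hx : ∀ t, Cross α t R₁ ∧ Cross α t R₂ ↔ Cross α t τ := by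
    intro t
    refine ⟨fun ⟨h3, h4⟩ => ?_, fun h =>
      ⟨p1 α hα ⟨e, he⟩ ⟨a, ha⟩ t h, p2 α hα ⟨e, he⟩ ⟨b, hb⟩ t h⟩⟩
    have ht := h3.isReflection
    have h5 := hbet t 1 ht
    have h6 := hbet t (t * 1) ht
    rw [cross_iff_meets ht 1] at h3 h4 ⊢
    tauto
  obtain ⟨v₁, hv₁, -⟩ := hα.exists_mem_projRes ha hb
  obtain ⟨v₂, hv₂, -⟩ := hα.exists_mem_projRes hb ha
  obtain ⟨c, hc⟩ := hα.gate_mem_range hv₁ e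
  obtain ⟨d, hd⟩ := hα.gate_mem_range hv₂ e
  have hcP : α c ∈ (X.projRes R₁ R₂).1 := hc ▸ gate_mem _ _
  have hdQ : α d ∈ (X.projRes R₂ R₁).1 := hd ▸ gate_mem _ _
  have hcmin : cs.LeftMinimal (Wt (X.projRes R₁ R₂)) (c⁻¹ * e) := by
    rw [← hα.2, hc]; exact leftMinimal_gate _ _
  have hdmin : cs.LeftMinimal (Wt (X.projRes R₂ R₁)) (d⁻¹ * e) := by
    rw [← hα.2, hd]; exact leftMinimal_gate _ _
  have hPτ : ∀ t, Cross α t (X.projRes R₁ R₂) ↔ Cross α t τ := fun t => by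
    rw [hα.cross_projRes_iff ha hb, hx]
  have hQτ : ∀ t, Cross α t (X.projRes R₂ R₁) ↔ Cross α t τ := fun t => by
    rw [hα.cross_projRes_iff hb ha, and_comm, hx]
  refine hα.mem_of_between h𝓡 (h𝓡.2 R₂ h2 R₁ h1) he hdQ hQτ hdmin (h𝓡.2 R₁ h1 R₂ h2) hcP hPτ
    hcmin fun t h3 h4 => ?_
  have ht := h3.1
  have h5 : ¬ Cross α t τ := fun h => hα.not_cross_of_sep hcP hcmin h3 ((hPτ t).2 h)
  have h6 : Meets α e t τ := ⟨e, he, fun h => h.2 Iff.rfl⟩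
  have h7 : Meets α (t * e) t (X.projRes R₁ R₂) :=
    (meets_mul_iff α ht e _).2 ⟨c, hcP, h3.symm⟩
  have h8 : Meets α (t * e) t (X.projRes R₂ R₁) := (meets_mul_iff α ht e _).2 ⟨d, hdQ, h4⟩
  rw [hα.meets_projRes_iff ha hb ht] at h7
  rw [hα.meets_projRes_iff hb ha ht] at h8
  have h9 := hbet t (t * e) ht
  rw [cross_iff_meets ht e] at h5
  tauto

theorem conv2_eq_resClosure_interval (R₁ R₂ : X.Res) :
    X.conv2 R₁ R₂ = X.resClosure (X.interval R₁ R₂) := by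
  refine (conv2_subset_resClosure_interval R₁ R₂).antisymm fun σ hσ _ h𝓢 => ?_
  exact hσ _ ⟨h𝓢.1.1, fun τ hτ => ConvexResSet.mem_of_mem_interval h𝓢.1
    (h𝓢.2 (Set.mem_insert _ _)) (h𝓢.2 (Set.mem_insert_of_mem _ rfl)) hτ⟩

theorem projRes_mem_conv2 (R₁ R₂ : X.Res) : X.projRes R₁ R₂ ∈ X.conv2 R₁ R₂ := fun _ h𝓢 =>
  h𝓢.1.2 R₁ (h𝓢.2 (Set.mem_insert _ _)) R₂ (h𝓢.2 (Set.mem_insert_of_mem _ rfl))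

end Bldg

/-- `Conv(R₁,R₂)` coincides with the closure of the interval
`[R₁,R₂]`; consequently a set of spherical residues is convex iff it is closed
and contains all intervals between its elements. -/
theorem statement3 {cs : CoxeterSystem M W} (X : Bldg cs) :
    (∀ R₁ R₂ : X.Res, X.conv2 R₁ R₂ = X.resClosure (X.interval R₁ R₂)) ∧
    ∀ 𝓡 : Set X.Res, X.ConvexResSet 𝓡 ↔
      (X.ClosedResSet 𝓡 ∧ ∀ R₁ ∈ 𝓡, ∀ R₂ ∈ 𝓡, X.interval R₁ R₂ ⊆ 𝓡) := by
  refine ⟨Bldg.conv2_eq_resClosure_interval, fun 𝓡 => ⟨fun h => ⟨h.1, fun R₁ h1 R₂ h2 σ hσ =>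
    Bldg.ConvexResSet.mem_of_mem_interval h h1 h2 hσ⟩, fun h => ⟨h.1, fun R₁ h1 R₂ h2 => ?_⟩⟩⟩
  have h3 := Bldg.projRes_mem_conv2 R₁ R₂
  rw [Bldg.conv2_eq_resClosure_interval] at h3
  exact h3 𝓡 ⟨h.1, h.2 R₁ h1 R₂ h2⟩
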